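/- arXiv:1906.08010 — 5 statements merged into one kernel-verified Lean document; each statement's English description precedes it below -/
import Mathlib

section
/- The permutations τ_n satisfy the recursions τ_{2k+1} = (k+1, k+2, …, 2k+1) · τ_{2k} and τ_{2k} = (k+1, k+2, …, 2k) · τ_{2k−1}, where (a, a+1, …, b) denotes a cycle. -/
/-- `τ_n` (0-based realization): `τ_n(2t−1) = t` and `τ_n(2t) = n+1−t` in 1-based terms. -/
def IsTau (n : ℕ) (τ : Equiv.Perm (Fin n)) : Prop :=
  (∀ i : Fin n, i.val % 2 = 0 → (τ i).val = i.val / 2) ∧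
  (∀ i : Fin n, i.val % 2 = 1 → (τ i).val = n - (i.val + 1) / 2)

/-- `c` is the cycle `(a+1, a+2, …, b+1)` in 1-based terms, i.e. on the 0-based
indices `a, a+1, …, b`: it sends `i ↦ i+1` for `a ≤ i < b`, sends `b ↦ a`, and fixes
everything else. -/
def IsCycleRange (n a b : ℕ) (c : Equiv.Perm (Fin n)) : Prop :=
  (∀ i : Fin n, i.val < a → c i = i) ∧
  (∀ i : Fin n, b < i.val → c i = i) ∧
  (∀ i : Fin n, a ≤ i.val → i.val < b → (c i).val = i.val + 1) ∧
  (∀ i : Fin n, i.val = b → (c i).val = a)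

/-- `σ ∈ S_n` is the image of `τ' ∈ S_m` under the natural embedding `S_m ⊆ S_n`
(fixing the letters `m+1, …, n`). -/
def IsEmbed (m n : ℕ) (τ' : Equiv.Perm (Fin m)) (σ : Equiv.Perm (Fin n)) : Prop :=
  (∀ i : Fin n, (h : i.val < m) → (σ i).val = (τ' ⟨i.val, h⟩).val) ∧
  (∀ i : Fin n, m ≤ i.val → σ i = i)

/-- Uniform form of the recursion: `τ_{m+1} = (⌈m/2⌉+1, …, m+1) · τ_m`. -/
theorem IsTau.eq_cycle_mul_embed {m n a b : ℕ} (hn : n = m + 1) (ha : a = (m + 1) / 2)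
    (hb : b = m) {τ : Equiv.Perm (Fin n)} (hτ : IsTau n τ)
    {τ' : Equiv.Perm (Fin m)} (hτ' : IsTau m τ')
    {σ : Equiv.Perm (Fin n)} (hσ : IsEmbed m n τ' σ)
    {c : Equiv.Perm (Fin n)} (hc : IsCycleRange n a b c) :
    τ = c * σ := by
  obtain ⟨hc_low, -, hc_mid, hc_top⟩ := hc
  ext i
  have hi := i.isLt
  rw [Equiv.Perm.mul_apply]
  by_cases him : i.val < m
  · have hσi := hσ.1 i him
    rcases Nat.mod_two_eq_zero_or_one i.val with hpar | hpar
    · have h := hτ.1 i hpar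
      have h' := hτ'.1 ⟨i.val, him⟩ hpar
      simp only at h'
      rw [hc_low (σ i) (by omega)]
      omega
    · have h := hτ.2 i hpar
      have h' := hτ'.2 ⟨i.val, him⟩ hpar
      simp only at h'
      rw [hc_mid (σ i) (by omega) (by omega)]
      omega
  · rw [hσ.2 i (by omega), hc_top i (by omega)]
    rcases Nat.mod_two_eq_zero_or_one i.val with hpar | hpar
    · have h := hτ.1 i hpar
      omega
    · have h := hτ.2 i hpar
      omega

/-- The recursions `τ_{2k+1} = (k+1, k+2, …, 2k+1) · τ_{2k}` and
`τ_{2k} = (k+1, k+2, …, 2k) · τ_{2k−1}`, where `S_{n−1} ⊆ S_n` via the natural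
embedding fixing `n`. -/
theorem tau_recursion (k : ℕ) (hk : 1 ≤ k)
    (τodd : Equiv.Perm (Fin (2 * k + 1))) (hτodd : IsTau (2 * k + 1) τodd)
    (τeven : Equiv.Perm (Fin (2 * k))) (hτeven : IsTau (2 * k) τeven)
    (τodd' : Equiv.Perm (Fin (2 * k - 1))) (hτodd' : IsTau (2 * k - 1) τodd')
    (σ : Equiv.Perm (Fin (2 * k + 1))) (hσ : IsEmbed (2 * k) (2 * k + 1) τeven σ)
    (σ' : Equiv.Perm (Fin (2 * k))) (hσ' : IsEmbed (2 * k - 1) (2 * k) τodd' σ')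
    (c : Equiv.Perm (Fin (2 * k + 1))) (hc : IsCycleRange (2 * k + 1) k (2 * k) c)
    (c' : Equiv.Perm (Fin (2 * k))) (hc' : IsCycleRange (2 * k) k (2 * k - 1) c') :
    τodd = c * σ ∧ τeven = c' * σ' := by
  exact ⟨hτodd.eq_cycle_mul_embed rfl (by omega) rfl hτeven hσ hc,
    hτeven.eq_cycle_mul_embed (by omega) (by omega) rfl hτodd' hσ' hc'⟩
end

section
/- Let n ≥ 1 and U = {(i,j) : 1 ≤ i < j ≤ n, i + j ≠ n+1}, r = ⌊n/2⌋. Suppose P' ⊆ U and y' ∈ S_n with y'(1) < fixed coset condition (y'(n−(r−1)) < … < y'(n)) satisfy ε_1 + ⋯ + ε_r + Σ_{(i,j)∈P'} (ε_i + ε_j) = Σ_i (n − y'^{-1}(i)) ε_i in ℤ^n (where ε_i is the i-th standard basis vector). Then y' is the identity and P' = {(i,j) : 1 ≤ i < j, i + j ≤ n}. -/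
open Finset

/-- A loopless graph on `Fin n` whose degree at `a` is `n - 1 - a` or `n - 2 - a` for every `a` is
the threshold graph in which `a ≠ b` are adjacent if and only if `a + b < n - 1`. -/
theorem mem_neighbors_iff_of_card {n : ℕ} (N : Fin n → Finset (Fin n))
    (hsymm : ∀ a b, a ∈ N b → b ∈ N a) (hirr : ∀ a, a ∉ N a)
    (hle : ∀ a, (N a).card + a.val + 1 ≤ n) (hge : ∀ a, n ≤ (N a).card + a.val + 2)
    (a b : Fin n) : b ∈ N a ↔ a ≠ b ∧ a.val + b.val + 1 < n := by
  have key : ∀ k : ℕ, ∀ a : Fin n, a.val = k → a.val + 1 + a.val < n →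
      N a = (Iio a.rev).erase a ∧ N a.rev = Iio a := by
    intro k
    induction k using Nat.strong_induction_on with
    | _ k ih =>
      intro a hak ha
      have hrev : N a.rev = Iio a := by
        symm
        apply Finset.eq_of_subset_of_card_le
        · intro b hb
          rw [mem_Iio, Fin.lt_def] at hb
          apply hsymm
          rw [(ih b (by omega) b rfl (by omega)).1]
          simp only [mem_erase, mem_Iio, ne_eq, Fin.ext_iff, Fin.lt_def, Fin.val_rev]
          omega
        · have := hle a.rev
          rw [Fin.val_rev] at this
          rw [Fin.card_Iio]
          omega
      refine ⟨?_, hrev⟩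
      apply Finset.eq_of_subset_of_card_le
      · intro b hb
        rw [mem_erase, mem_Iio]
        refine ⟨fun h => hirr a (h ▸ hb), ?_⟩
        by_contra! hlt
        rcases hlt.eq_or_lt with h | h
        · have := hsymm _ _ hb
          rw [← h, hrev] at this
          simp at this
        · rw [Fin.lt_def, Fin.val_rev] at h
          have hb' := (ih b.rev.val (by rw [Fin.val_rev]; omega) b.rev rfl
            (by rw [Fin.val_rev]; omega)).2
          have := hsymm _ _ hb
          rw [Fin.rev_rev] at hb'
          rw [hb', mem_Iio, Fin.lt_def, Fin.val_rev] at this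
          omega
      · rw [card_erase_of_mem (by rw [mem_Iio, Fin.lt_def, Fin.val_rev]; omega), Fin.card_Iio,
          Fin.val_rev]
        have := hge a
        omega
  have low : ∀ a b : Fin n, a.val + 1 + a.val < n →
      (b ∈ N a ↔ a ≠ b ∧ a.val + b.val + 1 < n) := by
    intro a b ha
    rw [(key _ a rfl ha).1]
    simp only [mem_erase, mem_Iio, ne_eq, Fin.ext_iff, Fin.lt_def, Fin.val_rev]
    omega
  have high : ∀ a b : Fin n, n < a.val + 1 + a.val →
      (b ∈ N a ↔ a ≠ b ∧ a.val + b.val + 1 < n) := by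
    intro a b ha
    have := (key _ a.rev rfl (by rw [Fin.val_rev]; omega)).2
    rw [Fin.rev_rev] at this
    rw [this]
    simp only [mem_Iio, ne_eq, Fin.ext_iff, Fin.lt_def, Fin.val_rev]
    omega
  have comm : b ∈ N a ↔ a ∈ N b := ⟨hsymm b a, hsymm a b⟩
  rcases lt_trichotomy (a.val + 1 + a.val) n with h | h | h
  · exact low a b h
  · rcases lt_trichotomy a.val b.val with hab | hab | hab
    · rw [comm, high b a (by omega), ne_comm, add_comm b.val]
    · obtain rfl := Fin.ext hab
      simp [hirr]
    · rw [comm, low b a (by omega), ne_comm, add_comm b.val]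
  · exact high a b h

/-- The degree vector of a graph, given by its set `P` of edges `(i, j)` with `i < j`, counts
neighbors. -/
theorem sum_single_add_single_apply {n : ℕ} (P : Finset (Fin n × Fin n))
    (hP : ∀ p ∈ P, p.1 < p.2) (u : Fin n) :
    (∑ p ∈ P, (Pi.single p.1 (1 : ℤ) + Pi.single p.2 (1 : ℤ)) : Fin n → ℤ) u =
      ((univ.filter fun v => (u, v) ∈ P ∨ (v, u) ∈ P).card : ℤ) := by
  have h₁ : (univ.filter fun v => (u, v) ∈ P).card = (P.filter fun p => p.1 = u).card := by
    refine card_bij' (fun v _ => (u, v)) (fun p _ => p.2) ?_ ?_ ?_ ?_ <;> aesop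
  have h₂ : (univ.filter fun v => (v, u) ∈ P).card = (P.filter fun p => p.2 = u).card := by
    refine card_bij' (fun v _ => (v, u)) (fun p _ => p.1) ?_ ?_ ?_ ?_ <;> aesop
  rw [filter_or, card_union_of_disjoint, h₁, h₂]
  · simp [Finset.sum_apply, Pi.single_apply, sum_add_distrib, eq_comm]
  · rw [disjoint_filter]
    exact fun v _ h h' => lt_asymm (hP _ h) (hP _ h')

/-- Let `n ≥ 1`, `r = ⌊n/2⌋`, `U = {(i,j) : 1 ≤ i < j ≤ n, i+j ≠ n+1}` (here realized
0-based on `Fin n`).  If `P' ⊆ U` and `y' ∈ S_n` satisfying the coset condition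
`y'(n−r+1) < ⋯ < y'(n)` are such that
`ε_1 + ⋯ + ε_r + Σ_{(i,j)∈P'} (ε_i + ε_j) = y'ρ` where `ρ = Σ_i (n−i)ε_i`,
then `y' = Id` and `P' = {(i,j) : i < j, i + j ≤ n}`. -/
theorem regular_term_unique (n : ℕ) (hn : 1 ≤ n) (r : ℕ) (hr : r = n / 2)
    (P' : Finset (Fin n × Fin n))
    (hP'U : ∀ p ∈ P', p.1 < p.2 ∧ (p.1.val + 1) + (p.2.val + 1) ≠ n + 1)
    (y' : Equiv.Perm (Fin n))
    (hcoset : ∀ a b : Fin n, n - r ≤ a.val → a < b → y' a < y' b)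
    (heq : (∑ i ∈ univ.filter (fun i : Fin n => i.val < r), Pi.single i (1 : ℤ)) +
        ∑ p ∈ P', (Pi.single p.1 (1 : ℤ) + Pi.single p.2 (1 : ℤ)) =
      fun i : Fin n => (n : ℤ) - 1 - ((y'.symm i).val : ℤ)) :
    y' = 1 ∧
      P' = univ.filter
        (fun p : Fin n × Fin n => p.1 < p.2 ∧ (p.1.val + 1) + (p.2.val + 1) ≤ n) := by
  subst hr
  set N : Fin n → Finset (Fin n) := fun a =>
    univ.filter fun b => (y' a, y' b) ∈ P' ∨ (y' b, y' a) ∈ P' with hN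
  have hmem : ∀ a b, b ∈ N a ↔ (y' a, y' b) ∈ P' ∨ (y' b, y' a) ∈ P' := by simp [hN]
  have hlt : ∀ p ∈ P', p.1 < p.2 := fun p hp => (hP'U p hp).1
  have hdeg : ∀ a, (if (y' a).val < n / 2 then 1 else 0) + (N a).card + a.val + 1 = n := by
    intro a
    have h := congrFun heq (y' a)
    have hcard : (N a).card =
        (univ.filter fun v => (y' a, v) ∈ P' ∨ (v, y' a) ∈ P').card :=
      card_equiv y' (by simp [hN])
    rw [Pi.add_apply, sum_single_add_single_apply P' hlt, ← hcard, Finset.sum_apply] at h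
    simp only [Pi.single_apply, Equiv.symm_apply_apply, sum_ite_eq, mem_filter, mem_univ,
      true_and] at h
    split_ifs at h ⊢ <;> omega
  have hadj : ∀ a b, b ∈ N a ↔ a ≠ b ∧ a.val + b.val + 1 < n := by
    refine mem_neighbors_iff_of_card N (fun a b h => ?_) (fun a h => ?_) (fun a => ?_)
      (fun a => ?_)
    · rw [hmem] at h ⊢
      exact h.symm
    · rw [hmem, or_self] at h
      exact lt_irrefl _ (hlt _ h)
    · have := hdeg a
      omega
    · have := hdeg a
      split_ifs at this <;> omega
  have hlow : ∀ a : Fin n, a.val < n / 2 → (y' a).val < n / 2 := by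
    intro a ha
    by_contra h
    have hd := hdeg a
    rw [if_neg h] at hd
    have hsub : N a ⊆ (Iio a.rev).erase a := by
      intro b hb
      rw [hadj] at hb
      simp only [mem_erase, mem_Iio, ne_eq, Fin.ext_iff, Fin.lt_def, Fin.val_rev] at hb ⊢
      omega
    have hc := card_le_card hsub
    rw [card_erase_of_mem (by rw [mem_Iio, Fin.lt_def, Fin.val_rev]; omega), Fin.card_Iio,
      Fin.val_rev] at hc
    omega
  have hrev_low : ∀ k : ℕ, ∀ a : Fin n, a.val = k → k < n / 2 → (y' a).rev = y' a.rev := by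
    intro k
    induction k using Nat.strong_induction_on with
    | _ k ih =>
      intro a hak hk
      obtain ⟨c, hc⟩ := y'.surjective (y' a).rev
      have hya := hlow a (by omega)
      have hcv : (y' c).val = n - ((y' a).val + 1) := by rw [hc, Fin.val_rev]
      have hca : a ≠ c := by
        rintro rfl
        omega
      have hnot : c ∉ N a := by
        rw [hmem]
        rintro (h | h) <;> have := (hP'U _ h).2 <;> dsimp only at this <;> omega
      rw [hadj, not_and] at hnot
      have hge := hnot hca
      rw [← hc]
      congr 1
      by_contra hne
      rw [Fin.ext_iff, Fin.val_rev] at hne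
      have hcr : c.rev.val < k := by
        rw [Fin.val_rev]
        omega
      have h := ih _ hcr c.rev rfl (by omega)
      rw [Fin.rev_rev, hc, Fin.rev_inj, y'.injective.eq_iff] at h
      rw [h] at hcr
      omega
  have hrev : ∀ a : Fin n, (y' a).rev = y' a.rev := by
    have hhigh : ∀ a : Fin n, n < a.val + 1 + a.val → (y' a).rev = y' a.rev := by
      intro a ha
      have h := hrev_low _ a.rev rfl (by rw [Fin.val_rev]; omega)
      rw [Fin.rev_rev] at h
      rw [← h, Fin.rev_rev]
    intro a
    by_cases h₁ : a.val < n / 2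
    · exact hrev_low _ a rfl h₁
    by_cases h₂ : n < a.val + 1 + a.val
    · exact hhigh a h₂
    obtain ⟨c, hc⟩ := y'.surjective (y' a).rev
    have hne_rev : ∀ h : (y' c).rev = y' c.rev, c = a.rev := by
      intro h
      rw [hc, Fin.rev_rev, y'.injective.eq_iff] at h
      rw [h, Fin.rev_rev]
    by_cases h₃ : c.val < n / 2
    · rw [← hc, hne_rev (hrev_low _ c rfl h₃)]
    by_cases h₄ : n < c.val + 1 + c.val
    · rw [← hc, hne_rev (hhigh c h₄)]
    rw [← hc]
    congr 1
    rw [Fin.ext_iff, Fin.val_rev]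
    omega
  have hrev_val : ∀ a : Fin n, (y' a.rev).val = n - ((y' a).val + 1) := by
    intro a
    rw [← hrev, Fin.val_rev]
  have hmid : ∀ a : Fin n, a.val + 1 + a.val = n → (y' a).val + 1 + (y' a).val = n := by
    intro a ha
    have h := hrev_val a
    have : a.rev = a := by
      rw [Fin.ext_iff, Fin.val_rev]
      omega
    rw [this] at h
    omega
  have hhigh : ∀ a : Fin n, n < a.val + 1 + a.val → n < (y' a).val + 1 + (y' a).val := by
    intro a ha
    have h := hrev_val a
    have := hlow a.rev (by rw [Fin.val_rev]; omega)
    omega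
  have hmono : StrictMono y' := by
    intro a b hab
    by_cases hb : n < b.val + 1 + b.val
    · by_cases ha : n < a.val + 1 + a.val
      · exact hcoset a b (by omega) hab
      · have := hhigh b hb
        rw [Fin.lt_def]
        rcases lt_or_eq_of_le (not_lt.mp ha) with h | h
        · have := hlow a (by omega)
          omega
        · have := hmid a h
          omega
    · rw [Fin.lt_def] at hab ⊢
      have ha := hlow a (by omega)
      rcases lt_or_eq_of_le (not_lt.mp hb) with h | h
      · have h₁ := hcoset b.rev a.rev (by rw [Fin.val_rev]; omega) (Fin.rev_lt_rev.mpr hab)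
        rwa [← hrev, ← hrev, Fin.rev_lt_rev] at h₁
      · have := hmid b h
        omega
  have hy : y' = 1 := by
    ext a
    have h : hmono.orderIsoOfSurjective y' y'.surjective = OrderIso.refl (Fin n) :=
      Subsingleton.elim _ _
    exact congrArg Fin.val (DFunLike.congr_fun h a)
  refine ⟨hy, ?_⟩
  ext ⟨i, j⟩
  have h := (hmem i j).symm.trans (hadj i j)
  simp only [hy, Equiv.Perm.one_apply] at h
  simp only [mem_filter, mem_univ, true_and]
  constructor
  · intro hij
    have := (h.mp (Or.inl hij)).2
    exact ⟨hlt _ hij, by omega⟩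
  · rintro ⟨hij, hle⟩
    exact (h.mpr ⟨hij.ne, by omega⟩).resolve_right fun hji => lt_asymm hij (hlt _ hji)
end

section
/- (Thin denominator identity for p(n).) Let n ≥ 2, r = ⌊n/2⌋, ρ = Σ_{i=1}^n (n−i)ε_i, β_k = −(ε_{2k−1} + ε_{2k}) for 1 ≤ k ≤ r, and ρ^⇑ = ε_1 + ε_3 + ⋯ + ε_{2r−1}. Then in the field of fractions of ℚ[ℤ^n]: e^{ρ} · ∏_{i<j}(1 − e^{ε_j − ε_i}) / ∏_{i<j}(1 − e^{ε_i + ε_j}) = (1/r!) Σ_{w ∈ S_n} sgn(w) · w( e^{ρ^⇑} / ∏_{k=1}^r (1 − e^{−β_k}) ). -/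
open Finset

instance (n : ℕ) : IsDomain (AddMonoidAlgebra ℚ (Fin n → ℤ)) :=
  NoZeroDivisors.to_isDomain _

open Polynomial in
lemma two_mul_sum_prod_erase {K : Type*} [Field K] [CharZero K] [DecidableEq K] (Y : Finset K)
    (hY : ∀ y ∈ Y, y * y ≠ 1) :
    2 * ∑ b ∈ Y, ∏ c ∈ Y.erase b, (1 - b * c) / (b - c) = 1 - (-1) ^ #Y := by
  have h1 : (1 : K) ∉ Y := fun h => hY _ h (by ring)
  have h2 : (-1 : K) ∉ Y := fun h => hY _ h (by ring)
  have h3 : (1 : K) ≠ -1 := by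
    intro h
    have : (2 : K) = 0 := by linear_combination h
    norm_num at this
  have h4 : (1 : K) ∉ insert (-1) Y := by simp [h3, h1]
  set T : Finset K := insert 1 (insert (-1) Y) with hT
  have hcard : #T = #Y + 2 := by rw [hT, card_insert_of_notMem h4, card_insert_of_notMem h2]
  set P : K[X] := ∏ c ∈ Y, (1 - C c * X) with hP
  have hdeg : P.natDegree ≤ #Y := by
    refine (natDegree_prod_le _ _).trans ?_
    simpa using sum_le_sum (s := Y) (f := fun c => (1 - C c * X : K[X]).natDegree)
      (g := fun _ => 1) fun c _ => by compute_degree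
  have hlt : P.degree < #T := by
    refine degree_le_natDegree.trans_lt ?_
    rw [hcard]
    exact_mod_cast (by omega : P.natDegree < #Y + 2)
  have key := Lagrange.coeff_eq_sum (s := T) (v := id) Function.injective_id.injOn hlt
  rw [coeff_eq_zero_of_natDegree_lt (by omega)] at key
  have hev : ∀ z, P.eval z = ∏ c ∈ Y, (1 - c * z) := fun z => by simp [hP, eval_prod]
  simp only [hev, id] at key
  rw [hT, sum_insert h4, sum_insert h2, ← hT] at key
  have e1 : T.erase 1 = insert (-1) Y := by rw [hT, erase_insert h4]
  have e2 : T.erase (-1) = insert 1 Y := by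
    rw [hT, Finset.insert_comm, erase_insert]
    simp [h3.symm, h2]
  have n1 : ∏ c ∈ Y, (1 - c) ≠ 0 := prod_ne_zero_iff.2 fun c hc h =>
    h1 (by rwa [sub_eq_zero.1 h])
  have n2 : ∏ c ∈ Y, (1 + c) ≠ 0 := prod_ne_zero_iff.2 fun c hc h =>
    h2 (by rwa [← eq_neg_of_add_eq_zero_right h])
  have t3 : ∀ b ∈ Y, (∏ c ∈ Y, (1 - c * b)) / ∏ c ∈ T.erase b, (b - c) =
      -∏ c ∈ Y.erase b, (1 - b * c) / (b - c) := by
    intro b hb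
    have hb1 : b ≠ 1 := fun h => h1 (h ▸ hb)
    have hb2 : b ≠ -1 := fun h => h2 (h ▸ hb)
    have e3 : T.erase b = insert 1 (insert (-1) (Y.erase b)) := by
      rw [hT, erase_insert_of_ne hb1.symm, erase_insert_of_ne hb2.symm]
    rw [e3, prod_insert (by simp [h3, h1]), prod_insert (by simp [h2]), ← mul_prod_erase Y _ hb,
      prod_div_distrib]
    have : ∏ c ∈ Y.erase b, (b - c) ≠ 0 := prod_ne_zero_iff.2 fun c hc h =>
      (ne_of_mem_erase hc) (sub_eq_zero.1 h).symm
    have hb1' := sub_ne_zero.2 hb1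
    have hb2' := sub_ne_zero.2 hb2
    simp only [mul_comm _ b]
    field_simp
    ring
  have p2 : ∏ c ∈ Y, (-1 - c) = (-1) ^ #Y * ∏ c ∈ Y, (1 + c) := by
    rw [← prod_const, ← prod_mul_distrib]
    exact prod_congr rfl fun c _ => by ring
  rw [sum_congr rfl t3, e1, e2, prod_insert h2, prod_insert h1, p2, sum_neg_distrib] at key
  simp only [mul_one, mul_neg, sub_neg_eq_add] at key
  have n3 : ((-1 : K)) ^ #Y * (-1) ^ #Y = 1 := by rw [← mul_pow]; simp
  have t1 : (∏ c ∈ Y, (1 - c)) / ((1 + 1) * ∏ c ∈ Y, (1 - c)) = 1 / 2 := by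
    field_simp; norm_num
  have t2 : (∏ c ∈ Y, (1 + c)) / ((-1 - 1) * ((-1) ^ #Y * ∏ c ∈ Y, (1 + c))) =
      -(-1) ^ #Y / 2 := by
    rw [div_eq_div_iff (by simp [n2]; norm_num) two_ne_zero]
    linear_combination (-2 * ∏ c ∈ Y, (1 + c)) * n3
  rw [t1, t2] at key
  linear_combination 2 * key

lemma two_mul_prod_sub_sum_prod_erase {K : Type*} [Field K] [CharZero K] [DecidableEq K]
    (Y : Finset K) (a : K) (ha : a ≠ 0) (haa : a * a ≠ 1) (haY : ∀ y ∈ Y, a * y ≠ 1)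
    (hY : ∀ y ∈ Y, y * y ≠ 1) :
    2 * (∏ c ∈ Y, (a - c) / (1 - a * c) -
      ∑ b ∈ Y, (a - b) / (1 - a * b) * ∏ c ∈ Y.erase b, (1 - b * c) / (b - c)) =
      1 + (-1) ^ #Y := by
  have hm : a⁻¹ ∉ Y := fun h => haY _ h (mul_inv_cancel₀ ha)
  have key := two_mul_sum_prod_erase (insert a⁻¹ Y) (by
    intro y hy
    rcases mem_insert.1 hy with rfl | hy
    · rw [← mul_inv, Ne, inv_eq_one]; exact haa
    · exact hY y hy)
  rw [sum_insert hm, erase_insert hm, card_insert_of_notMem hm] at key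
  have e1 : ∀ c ∈ Y, (1 - a⁻¹ * c) / (a⁻¹ - c) = (a - c) / (1 - a * c) := by
    intro c hc
    have h1 : 1 - a * c ≠ 0 := sub_ne_zero.2 (haY c hc).symm
    have h2 : a⁻¹ - c ≠ 0 := sub_ne_zero.2 fun h => hm (h ▸ hc)
    rw [div_eq_div_iff h2 h1]
    field_simp
  have e2 : ∀ b ∈ Y, ∏ c ∈ (insert a⁻¹ Y).erase b, (1 - b * c) / (b - c) =
      -((a - b) / (1 - a * b) * ∏ c ∈ Y.erase b, (1 - b * c) / (b - c)) := by
    intro b hb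
    have h1 : 1 - a * b ≠ 0 := sub_ne_zero.2 (haY b hb).symm
    have h2 : b - a⁻¹ ≠ 0 := sub_ne_zero.2 fun h => hm (h ▸ hb)
    rw [erase_insert_of_ne (sub_ne_zero.1 h2).symm, prod_insert (by simp [hm]), ← neg_mul]
    congr 1
    rw [← neg_div, div_eq_div_iff h2 h1]
    field_simp
    ring
  rw [prod_congr rfl e1, sum_congr rfl e2, sum_neg_distrib] at key
  rw [sub_eq_add_neg, key]
  ring

lemma sum_sum_prod_erase_erase {K : Type*} [Field K] [CharZero K] [DecidableEq K]
    (Z : Finset K) (h0 : ∀ z ∈ Z, z ≠ 0) (h1 : ∀ y ∈ Z, ∀ z ∈ Z, y * z ≠ 1) :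
    ∑ a ∈ Z, ∑ b ∈ Z.erase a, ∏ c ∈ (Z.erase a).erase b,
      ((1 - a * c) / (a - c) * ((1 - b * c) / (b - c))) = 2 * ((#Z / 2 : ℕ) : K) := by
  have step : ∀ a ∈ Z, 2 * ∑ b ∈ Z.erase a, ∏ c ∈ (Z.erase a).erase b,
      ((1 - a * c) / (a - c) * ((1 - b * c) / (b - c))) =
      2 - (1 - (-1) ^ #Z) * ∏ c ∈ Z.erase a, (1 - a * c) / (a - c) := by
    intro a ha
    have key := two_mul_prod_sub_sum_prod_erase (Z.erase a) a (h0 a ha) (h1 a ha a ha)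
      (fun y hy => h1 a ha y (mem_of_mem_erase hy))
      (fun y hy => h1 y (mem_of_mem_erase hy) y (mem_of_mem_erase hy))
    have hc : #Z = #(Z.erase a) + 1 := (card_erase_add_one ha).symm
    have hne : ∀ c ∈ Z.erase a, (1 - a * c) / (a - c) * ((a - c) / (1 - a * c)) = 1 := by
      intro c hc
      have h2 : 1 - a * c ≠ 0 := sub_ne_zero.2 (h1 a ha c (mem_of_mem_erase hc)).symm
      have h3 : a - c ≠ 0 := sub_ne_zero.2 (ne_of_mem_erase hc).symm
      field_simp
    have e1 : (∏ c ∈ Z.erase a, (1 - a * c) / (a - c)) * ∏ c ∈ Z.erase a, (a - c) / (1 - a * c)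
        = 1 := by
      rw [← prod_mul_distrib]; exact prod_eq_one hne
    have e2 : (∏ c ∈ Z.erase a, (1 - a * c) / (a - c)) * ∑ b ∈ Z.erase a, (a - b) / (1 - a * b) *
        ∏ c ∈ (Z.erase a).erase b, (1 - b * c) / (b - c) =
        ∑ b ∈ Z.erase a, ∏ c ∈ (Z.erase a).erase b,
          ((1 - a * c) / (a - c) * ((1 - b * c) / (b - c))) := by
      rw [mul_sum]
      refine sum_congr rfl fun b hb => ?_
      rw [← mul_prod_erase _ _ hb, prod_mul_distrib]
      linear_combination ((∏ c ∈ (Z.erase a).erase b, (1 - a * c) / (a - c)) *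
        ∏ c ∈ (Z.erase a).erase b, (1 - b * c) / (b - c)) * hne b hb
    rw [← e2, hc, pow_succ]
    linear_combination 2 * e1 - (∏ c ∈ Z.erase a, (1 - a * c) / (a - c)) * key
  have tot := two_mul_sum_prod_erase Z fun y hy => h1 y hy y hy
  have htot : 2 * (2 * ∑ a ∈ Z, ∑ b ∈ Z.erase a, ∏ c ∈ (Z.erase a).erase b,
      ((1 - a * c) / (a - c) * ((1 - b * c) / (b - c)))) =
      2 * (2 * #Z) - (1 - (-1) ^ #Z) * (1 - (-1) ^ #Z) := by
    rw [mul_sum, sum_congr rfl step, sum_sub_distrib, ← mul_sum, sum_const, nsmul_eq_mul]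
    linear_combination -(1 - (-1) ^ #Z) * tot
  have hfin : (1 - (-1) ^ #Z : K) * (1 - (-1) ^ #Z) = 4 * ((#Z % 2 : ℕ) : K) := by
    rcases Nat.even_or_odd #Z with h | h
    · simp [h.neg_one_pow, Nat.even_iff.1 h]
    · rw [h.neg_one_pow, Nat.odd_iff.1 h]; norm_num
  have hmod : (#Z : K) = ((#Z % 2 : ℕ) : K) + 2 * ((#Z / 2 : ℕ) : K) := by
    exact_mod_cast (Nat.mod_add_div #Z 2).symm
  have h4 : (4 : K) ≠ 0 := by norm_num
  apply mul_left_cancel₀ h4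
  linear_combination htot - hfin + 4 * hmod

lemma map_succ_trans_swap {n : ℕ} (p : Fin (n + 1)) :
    univ.map ((Fin.succEmb n).trans (Equiv.swap 0 p).toEmbedding) =
      univ.erase p := by
  ext i
  simp only [mem_map, mem_univ, true_and, mem_erase, and_true, Function.Embedding.trans_apply,
    Equiv.coe_toEmbedding, Fin.coe_succEmb]
  constructor
  · rintro ⟨j, rfl⟩ h
    have := (Equiv.swap 0 p).injective (h.trans (Equiv.swap_apply_left 0 p).symm)
    exact Fin.succ_ne_zero _ this
  · intro h
    obtain ⟨j, hj⟩ := Fin.exists_succ_eq.2 fun h' : Equiv.swap 0 p i = 0 => h (by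
      rw [← Equiv.swap_apply_self 0 p i, h', Equiv.swap_apply_left])
    exact ⟨j, by rw [hj, Equiv.swap_apply_self]⟩

lemma sum_perm_fin_succ {M α : Type*} [AddCommMonoid M] {n : ℕ} (x : Fin (n + 1) → α)
    (F : (Fin (n + 1) → α) → M) :
    ∑ w : Equiv.Perm (Fin (n + 1)), F (x ∘ w) =
      ∑ p, ∑ e : Equiv.Perm (Fin n),
        F (Fin.cons (x p) ((fun i => x (Equiv.swap 0 p i.succ)) ∘ e)) := by
  rw [← Equiv.Perm.decomposeFin.symm.sum_comp, Fintype.sum_prod_type]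
  refine sum_congr rfl fun p _ => sum_congr rfl fun e _ => ?_
  congr 1
  ext i
  refine Fin.cases ?_ (fun j => ?_) i <;> simp

section
variable {K : Type*} [Field K]

/-- The ratio of `∏ k, x (2k) / (1 - x (2k) * x (2k+1))` to `∏ i < j, (x i - x j) / (1 - x i * x j)`,
written recursively. -/
def pairRatio : (n : ℕ) → (Fin n → K) → K
  | 0, _ => 1
  | 1, _ => 1
  | n + 2, x => x 0 / (x 0 - x 1) * (∏ c : Fin n,
      ((1 - x 0 * x c.succ.succ) / (x 0 - x c.succ.succ) *
        ((1 - x 1 * x c.succ.succ) / (x 1 - x c.succ.succ)))) *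
      pairRatio n fun c => x c.succ.succ

lemma prod_pairs_eq_prod_mul_pairRatio (n r : ℕ) (hr : r = n / 2) (x : Fin n → K)
    (hx : Function.Injective x) (h1 : ∀ i j, x i * x j ≠ 1) :
    ∏ k : Fin r, x ⟨2 * k, by omega⟩ /
      (1 - x ⟨2 * k, by omega⟩ * x ⟨2 * k + 1, by omega⟩) =
    (∏ i, ∏ j ∈ Ioi i, (x i - x j) / (1 - x i * x j)) * pairRatio n x := by
  induction n using Nat.twoStepInduction generalizing r with
  | zero => subst hr; simp [pairRatio]
  | one => subst hr; simp [pairRatio]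
  | more n ih _ =>
    obtain rfl : r = n / 2 + 1 := by omega
    have ih' := ih (n / 2) rfl (fun c => x c.succ.succ)
      (fun i j h => Fin.succ_injective _ (Fin.succ_injective _ (hx h))) (fun i j => h1 _ _)
    have hne : ∀ i j, i ≠ j →
        (x i - x j) / (1 - x i * x j) * ((1 - x i * x j) / (x i - x j)) = 1 := by
      intro i j hij
      have h2 : 1 - x i * x j ≠ 0 := sub_ne_zero.2 (h1 i j).symm
      have h3 : x i - x j ≠ 0 := sub_ne_zero.2 (hx.ne hij)
      field_simp
    have e0 : (∏ c : Fin n, (x 0 - x c.succ.succ) / (1 - x 0 * x c.succ.succ)) *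
        ∏ c : Fin n, (1 - x 0 * x c.succ.succ) / (x 0 - x c.succ.succ) = 1 := by
      rw [← prod_mul_distrib]
      exact prod_eq_one fun c _ => hne _ _ (Fin.succ_ne_zero _).symm
    have e1 : (∏ c : Fin n, (x 1 - x c.succ.succ) / (1 - x 1 * x c.succ.succ)) *
        ∏ c : Fin n, (1 - x 1 * x c.succ.succ) / (x 1 - x c.succ.succ) = 1 := by
      rw [← prod_mul_distrib]
      refine prod_eq_one fun c _ => hne _ _ fun h => ?_
      rw [← Fin.succ_zero_eq_one] at h
      exact Fin.succ_ne_zero c (Fin.succ_injective _ h).symm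
    have e01 : (x 0 - x 1) / (1 - x 0 * x 1) * (x 0 / (x 0 - x 1)) = x 0 / (1 - x 0 * x 1) := by
      have h3 : x 0 - x 1 ≠ 0 := sub_ne_zero.2 (hx.ne (by simp))
      field_simp
    have hP : (∏ i, ∏ j ∈ Ioi i, (x i - x j) / (1 - x i * x j)) =
        (x 0 - x 1) / (1 - x 0 * x 1) *
        (∏ c : Fin n, (x 0 - x c.succ.succ) / (1 - x 0 * x c.succ.succ)) *
        (∏ c : Fin n, (x 1 - x c.succ.succ) / (1 - x 1 * x c.succ.succ)) *
        ∏ i : Fin n, ∏ j ∈ Ioi i, (x i.succ.succ - x j.succ.succ) /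
          (1 - x i.succ.succ * x j.succ.succ) := by
      rw [Fin.prod_univ_succ, Fin.prod_univ_succ, ← Fin.succ_zero_eq_one]
      simp only [Fin.prod_Ioi_zero, Fin.prod_Ioi_succ, Fin.prod_univ_succ]
      ring
    rw [Fin.prod_univ_succ, hP, pairRatio, prod_mul_distrib]
    have hrest : ∏ k : Fin (n / 2), x ⟨2 * (k.succ : Fin (n / 2 + 1)), by omega⟩ /
        (1 - x ⟨2 * (k.succ : Fin (n / 2 + 1)), by omega⟩ *
          x ⟨2 * (k.succ : Fin (n / 2 + 1)) + 1, by omega⟩) =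
        (∏ i : Fin n, ∏ j ∈ Ioi i, (x i.succ.succ - x j.succ.succ) /
          (1 - x i.succ.succ * x j.succ.succ)) * pairRatio n fun c => x c.succ.succ := ih'
    rw [hrest]
    have hfirst : x ⟨2 * ((0 : Fin (n / 2 + 1)) : ℕ), by simp⟩ /
        (1 - x ⟨2 * ((0 : Fin (n / 2 + 1)) : ℕ), by simp⟩ *
          x ⟨2 * ((0 : Fin (n / 2 + 1)) : ℕ) + 1, by simp⟩) = x 0 / (1 - x 0 * x 1) := rfl
    rw [hfirst, ← e01]
    set A := (∏ c : Fin n, (x 0 - x c.succ.succ) / (1 - x 0 * x c.succ.succ))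
    set A' := ∏ c : Fin n, (1 - x 0 * x c.succ.succ) / (x 0 - x c.succ.succ)
    set B := (∏ c : Fin n, (x 1 - x c.succ.succ) / (1 - x 1 * x c.succ.succ))
    set B' := ∏ c : Fin n, (1 - x 1 * x c.succ.succ) / (x 1 - x c.succ.succ)
    set D := ∏ i : Fin n, ∏ j ∈ Ioi i, (x i.succ.succ - x j.succ.succ) /
          (1 - x i.succ.succ * x j.succ.succ)
    set G := pairRatio n fun c => x c.succ.succ
    set f := (x 0 - x 1) / (1 - x 0 * x 1) * (x 0 / (x 0 - x 1)) with hf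
    have : (x 0 - x 1) / (1 - x 0 * x 1) * A * B * D *
        (x 0 / (x 0 - x 1) * (A' * B') * G) = f * D * G * (A * A') * (B * B') := by
      rw [hf]; ring
    rw [this, e0, e1]; ring

lemma sum_symm_div_sub {ι : Type*} [DecidableEq ι] (s : Finset ι) (x : ι → K) [CharZero K]
    (hx : Set.InjOn x s) (F : ι → ι → K) (hF : ∀ i j, F i j = F j i) :
    2 * ∑ i ∈ s, ∑ j ∈ s.erase i, x i / (x i - x j) * F i j =
      ∑ i ∈ s, ∑ j ∈ s.erase i, F i j := by
  have hswap : ∑ i ∈ s, ∑ j ∈ s.erase i, x i / (x i - x j) * F i j =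
      ∑ i ∈ s, ∑ j ∈ s.erase i, x j / (x j - x i) * F i j := by
    rw [sum_comm' (t' := s) (s' := fun j => s.erase j) (by
      intro a b; simp only [mem_erase]; tauto)]
    exact sum_congr rfl fun i _ => sum_congr rfl fun j _ => by rw [hF]
  rw [two_mul]
  nth_rw 2 [hswap]
  simp only [← sum_add_distrib]
  refine sum_congr rfl fun i hi => sum_congr rfl fun j hj => ?_
  have h1 : x i - x j ≠ 0 := sub_ne_zero.2 fun h =>
    ne_of_mem_erase hj (hx hi (mem_of_mem_erase hj) h).symm
  have h2 : x j / (x j - x i) = -(x j / (x i - x j)) := by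
    rw [← neg_sub, div_neg]
  rw [h2, neg_mul, ← sub_eq_add_neg, ← sub_mul, ← sub_div, div_self h1, one_mul]

lemma sum_pairRatio [CharZero K] (n : ℕ) (x : Fin n → K) (hx : Function.Injective x)
    (h0 : ∀ i, x i ≠ 0) (h1 : ∀ i j, x i * x j ≠ 1) :
    ∑ w : Equiv.Perm (Fin n), pairRatio n (x ∘ w) = ((n / 2).factorial : K) := by
  classical
  induction n using Nat.twoStepInduction with
  | zero => simp [pairRatio]
  | one => simp [pairRatio]
  | more n ih _ =>
    set Φ : K → K → K → K := fun a b c => (1 - a * c) / (a - c) * ((1 - b * c) / (b - c))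
    have step : ∀ p : Fin (n + 2), ∀ q : Fin (n + 1),
        ∑ e : Equiv.Perm (Fin n), pairRatio (n + 2) (Fin.cons (x p) (Fin.cons
          (x (Equiv.swap 0 p q.succ))
          ((fun i => x (Equiv.swap 0 p (Equiv.swap 0 q i.succ).succ)) ∘ e))) =
        x p / (x p - x (Equiv.swap 0 p q.succ)) *
          (∏ c ∈ (univ.erase p).erase (Equiv.swap 0 p q.succ),
            Φ (x p) (x (Equiv.swap 0 p q.succ)) (x c)) * ((n / 2).factorial : K) := by
      intro p q
      rw [← ih (fun i => x (Equiv.swap 0 p (Equiv.swap 0 q i.succ).succ)), mul_sum]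
      · refine sum_congr rfl fun e _ => ?_
        rw [pairRatio]
        congr 2
        rw [← map_succ_trans_swap p]
        have := map_erase ((Fin.succEmb (n + 1)).trans (Equiv.swap 0 p).toEmbedding)
          univ q
        simp only [Function.Embedding.trans_apply,
          Equiv.coe_toEmbedding, Fin.coe_succEmb] at this
        rw [← this, prod_map, ← map_succ_trans_swap q, prod_map]
        simp only [Function.Embedding.trans_apply,
          Equiv.coe_toEmbedding, Fin.coe_succEmb]
        exact Equiv.prod_comp e fun i => Φ (x p) (x (Equiv.swap 0 p q.succ))
          (x (Equiv.swap 0 p (Equiv.swap 0 q i.succ).succ))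
      · intro i j h
        have := (Equiv.swap 0 p).injective (hx h)
        exact Fin.succ_injective _ ((Equiv.swap 0 q).injective (Fin.succ_injective _ this))
      · intro i; exact h0 _
      · intro i j; exact h1 _ _
    rw [sum_perm_fin_succ]
    have inner : ∀ p : Fin (n + 2), ∑ e : Equiv.Perm (Fin (n + 1)), pairRatio (n + 2)
        (Fin.cons (x p) ((fun i => x (Equiv.swap 0 p i.succ)) ∘ e)) =
        (∑ q ∈ univ.erase p, x p / (x p - x q) *
          ∏ c ∈ (univ.erase p).erase q, Φ (x p) (x q) (x c)) * ((n / 2).factorial : K) := by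
      intro p
      rw [sum_perm_fin_succ (fun i => x (Equiv.swap 0 p i.succ))
        (fun y => pairRatio (n + 2) (Fin.cons (x p) y))]
      rw [sum_congr rfl fun q _ => step p q, ← sum_mul]
      congr 1
      conv_rhs => rw [← map_succ_trans_swap p, sum_map]
      rw [map_succ_trans_swap p]
      rfl
    rw [sum_congr rfl fun p _ => inner p, ← sum_mul]
    have key := sum_sum_prod_erase_erase (univ.map ⟨x, hx⟩) (by simpa using h0) (by simpa using h1)
    have e1 : ∀ a, (univ.map ⟨x, hx⟩).erase (x a) = (univ.erase a).map ⟨x, hx⟩ := fun a =>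
      (map_erase ⟨x, hx⟩ univ a).symm
    have e2 : ∀ a b, ((univ.erase a).map ⟨x, hx⟩).erase (x b) =
        ((univ.erase a).erase b).map ⟨x, hx⟩ := fun a b =>
      (map_erase ⟨x, hx⟩ (univ.erase a) b).symm
    simp only [sum_map, prod_map, Function.Embedding.coeFn_mk, e1, e2, card_map, card_univ,
      Fintype.card_fin] at key
    rw [← sum_symm_div_sub univ x hx.injOn] at key
    · have h := mul_left_cancel₀ two_ne_zero key
      rw [h, Nat.add_div_right _ two_pos, Nat.factorial_succ]
      push_cast
      ring
    · intro i j
      rw [erase_right_comm]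
      exact prod_congr rfl fun c _ => mul_comm _ _

lemma sum_sign_mul_prod_pairs [CharZero K] (n r : ℕ) (hr : r = n / 2) (x : Fin n → K)
    (hx : Function.Injective x) (h0 : ∀ i, x i ≠ 0) (h1 : ∀ i j, x i * x j ≠ 1) :
    ∑ w : Equiv.Perm (Fin n), ((Equiv.Perm.sign w : ℤ) : K) *
      ∏ k : Fin r, x (w ⟨2 * k, by omega⟩) /
        (1 - x (w ⟨2 * k, by omega⟩) * x (w ⟨2 * k + 1, by omega⟩)) =
    (r.factorial : K) * ∏ i, ∏ j ∈ Ioi i, (x i - x j) / (1 - x i * x j) := by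
  subst hr
  rw [← sum_pairRatio n x hx h0 h1, sum_mul]
  refine sum_congr rfl fun w _ => ?_
  have h := prod_pairs_eq_prod_mul_pairRatio n _ rfl (x ∘ w) (hx.comp w.injective)
    fun i j => h1 _ _
  have hs := w.prod_Ioi_comp_eq_sign_mul_prod (f := fun i j => (x i - x j) / (1 - x i * x j))
    fun i j => by rw [← neg_div, neg_sub, mul_comm]
  have hsq : ((Equiv.Perm.sign w : ℤ) : K) * ((Equiv.Perm.sign w : ℤ) : K) = 1 := by
    rcases Int.units_eq_one_or (Equiv.Perm.sign w) with h | h <;> simp [h]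
  simp only [Function.comp_apply] at h
  rw [h, hs]
  linear_combination (∏ i, ∏ j ∈ Ioi i, (x i - x j) / (1 - x i * x j)) *
    pairRatio n (x ∘ w) * hsq

/-- The denominator identity for any injective homomorphism from `ℤ^n`, written additively, to the
units of a field of characteristic zero. -/
lemma denominator_identity [CharZero K] (n r : ℕ) (hr : r = n / 2) (E : (Fin n → ℤ) → K)
    (hadd : ∀ u v, E (u + v) = E u * E v) (hzero : E 0 = 1) (hinj : Function.Injective E)
    (ρ : Fin n → ℤ) (hρ : ρ = fun i => (n : ℤ) - 1 - (i.val : ℤ))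
    (ρup : Fin n → ℤ) (hρup : ρup = fun i => if i.val % 2 = 0 ∧ i.val < 2 * r then 1 else 0)
    (β : Fin r → (Fin n → ℤ))
    (hβ : ∀ k, β k = fun i => if i.val = 2 * k.val ∨ i.val = 2 * k.val + 1 then -1 else 0) :
    E ρ * (∏ p ∈ univ.filter (fun p : Fin n × Fin n => p.1 < p.2),
        (1 - E (Pi.single p.2 1 - Pi.single p.1 1)))
      / (∏ p ∈ univ.filter (fun p : Fin n × Fin n => p.1 < p.2),
        (1 - E (Pi.single p.1 1 + Pi.single p.2 1)))
    = (r.factorial : K)⁻¹ *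
        ∑ w : Equiv.Perm (Fin n), ((Equiv.Perm.sign w : ℤ) : K) *
            (E (ρup ∘ w.symm) / ∏ k : Fin r, (1 - E ((-(β k)) ∘ w.symm))) := by
  have hne : ∀ v, E v ≠ 0 := fun v h => by
    have := hadd v (-v)
    rw [add_neg_cancel, hzero, h, zero_mul] at this
    exact one_ne_zero this
  have hsum : ∀ {ι : Type} (s : Finset ι) (f : ι → Fin n → ℤ),
      E (∑ i ∈ s, f i) = ∏ i ∈ s, E (f i) := by
    classical
    intro ι s f
    induction s using Finset.induction_on with
    | empty => simpa using hzero
    | insert a s ha ih => rw [sum_insert ha, prod_insert ha, hadd, ih]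
  set x : Fin n → K := fun i => E (Pi.single i 1) with hx
  have hxinj : Function.Injective x := fun i j h => by
    by_contra hij
    have := congrFun (hinj h) i
    simp [hij] at this
  have hx1 : ∀ i j, x i * x j ≠ 1 := fun i j h => by
    rw [hx, ← hadd, ← hzero] at h
    have := congrFun (hinj h) i
    simp only [Pi.add_apply, Pi.single_apply, Pi.zero_apply, if_true] at this
    split_ifs at this <;> omega
  have hx0 : ∀ i, x i ≠ 0 := fun i => hne _
  have hpair : ∀ f : Fin n → Fin n → K,
      ∏ p ∈ univ.filter (fun p : Fin n × Fin n => p.1 < p.2), f p.1 p.2 =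
        ∏ i, ∏ j ∈ Ioi i, f i j := fun f => by
    rw [prod_filter, Fintype.prod_prod_type]
    refine prod_congr rfl fun i _ => ?_
    rw [← prod_filter]
    exact prod_congr (by ext; simp) fun _ _ => rfl
  have hEρ : E ρ = ∏ i, ∏ j ∈ Ioi i, x i := by
    have : ρ = ∑ i : Fin n, ∑ j ∈ Ioi i, Pi.single i 1 := by
      ext i
      simp only [hρ, sum_const, Fin.card_Ioi, Finset.sum_apply, Pi.smul_apply, Pi.single_apply]
      simp
      omega
    rw [this, hsum]
    exact prod_congr rfl fun i _ => hsum _ _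
  have hL : E ρ * (∏ p ∈ univ.filter (fun p : Fin n × Fin n => p.1 < p.2),
        (1 - E (Pi.single p.2 1 - Pi.single p.1 1)))
      / (∏ p ∈ univ.filter (fun p : Fin n × Fin n => p.1 < p.2),
        (1 - E (Pi.single p.1 1 + Pi.single p.2 1))) =
      ∏ i, ∏ j ∈ Ioi i, (x i - x j) / (1 - x i * x j) := by
    have hnum : ∏ p ∈ univ.filter (fun p : Fin n × Fin n => p.1 < p.2),
        (1 - E (Pi.single p.2 1 - Pi.single p.1 1)) =
        ∏ i, ∏ j ∈ Ioi i, (1 - E (Pi.single j 1 - Pi.single i 1)) :=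
      hpair fun i j => 1 - E (Pi.single j 1 - Pi.single i 1)
    have hden : ∏ p ∈ univ.filter (fun p : Fin n × Fin n => p.1 < p.2),
        (1 - E (Pi.single p.1 1 + Pi.single p.2 1)) =
        ∏ i, ∏ j ∈ Ioi i, (1 - E (Pi.single i 1 + Pi.single j 1)) :=
      hpair fun i j => 1 - E (Pi.single i 1 + Pi.single j 1)
    rw [hnum, hden, hEρ]
    simp only [← prod_mul_distrib, ← prod_div_distrib]
    refine prod_congr rfl fun i _ => prod_congr rfl fun j _ => ?_
    rw [hadd, mul_sub, mul_one, ← hadd, add_sub_cancel]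
  have hup : ∀ w : Equiv.Perm (Fin n), E (ρup ∘ w.symm) =
      ∏ k : Fin r, x (w ⟨2 * k, by omega⟩) := fun w => by
    rw [hx, ← hsum]
    congr 1
    ext i
    obtain ⟨j, rfl⟩ := w.surjective i
    simp only [hρup, Function.comp_apply, Equiv.symm_apply_apply, Finset.sum_apply, Pi.single_apply,
      w.injective.eq_iff]
    split_ifs with h
    · rw [sum_eq_single ⟨j.val / 2, by omega⟩]
      · rw [if_pos (Fin.ext (by simp; omega))]
      · intro k _ hk
        rw [if_neg]
        rintro rfl
        exact hk (Fin.ext (by simp))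
      · simp
    · refine (sum_eq_zero fun k _ => if_neg ?_).symm
      rintro rfl
      exact h ⟨by simp, by simp⟩
  have hβw : ∀ (w : Equiv.Perm (Fin n)) (k : Fin r), E ((-(β k)) ∘ w.symm) =
      x (w ⟨2 * k, by omega⟩) * x (w ⟨2 * k + 1, by omega⟩) := fun w k => by
    rw [hx, ← hadd]
    congr 1
    ext i
    obtain ⟨j, rfl⟩ := w.surjective i
    simp only [hβ, Function.comp_apply, Equiv.symm_apply_apply, Pi.neg_apply, Pi.add_apply,
      Pi.single_apply, w.injective.eq_iff, Fin.ext_iff]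
    split_ifs <;> omega
  rw [hL]
  simp only [hup, hβw, ← prod_div_distrib]
  rw [sum_sign_mul_prod_pairs n r hr x hxinj hx0 hx1, inv_mul_cancel_left₀]
  exact_mod_cast r.factorial_ne_zero

end

/-- Thin denominator identity for `p(n)`.  With `r = ⌊n/2⌋`, `ρ = Σ (n−i)ε_i`,
`β_k = −(ε_{2k−1}+ε_{2k})` and `ρ^⇑ = ε_1 + ε_3 + ⋯ + ε_{2r−1}`, in the fraction
field of `ℚ[ℤ^n]`:
`e^ρ ∏_{i<j}(1−e^{ε_j−ε_i}) / ∏_{i<j}(1−e^{ε_i+ε_j})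
  = (1/r!) Σ_w sgn(w) w( e^{ρ^⇑} / ∏_k (1−e^{−β_k}) )`. -/
theorem thin_denominator (n : ℕ) (hn : 2 ≤ n) (r : ℕ) (hr : r = n / 2)
    (E : (Fin n → ℤ) → FractionRing (AddMonoidAlgebra ℚ (Fin n → ℤ)))
    (hE : ∀ v, E v = algebraMap _ _ (AddMonoidAlgebra.single v (1 : ℚ)))
    (ρ : Fin n → ℤ) (hρ : ρ = fun i => (n : ℤ) - 1 - (i.val : ℤ))
    (ρup : Fin n → ℤ) (hρup : ρup = fun i => if i.val % 2 = 0 ∧ i.val < 2 * r then 1 else 0)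
    (β : Fin r → (Fin n → ℤ))
    (hβ : ∀ k, β k = fun i => if i.val = 2 * k.val ∨ i.val = 2 * k.val + 1 then -1 else 0) :
    E ρ * (∏ p ∈ univ.filter (fun p : Fin n × Fin n => p.1 < p.2),
        (1 - E (Pi.single p.2 1 - Pi.single p.1 1)))
      / (∏ p ∈ univ.filter (fun p : Fin n × Fin n => p.1 < p.2),
        (1 - E (Pi.single p.1 1 + Pi.single p.2 1)))
    = (r.factorial : FractionRing (AddMonoidAlgebra ℚ (Fin n → ℤ)))⁻¹ *
        ∑ w : Equiv.Perm (Fin n),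
          ((Equiv.Perm.sign w : ℤ) : FractionRing (AddMonoidAlgebra ℚ (Fin n → ℤ))) *
            (E (ρup ∘ w.symm) / ∏ k : Fin r, (1 - E ((-(β k)) ∘ w.symm))) := by
  have hmap := IsFractionRing.injective (AddMonoidAlgebra ℚ (Fin n → ℤ))
    (FractionRing (AddMonoidAlgebra ℚ (Fin n → ℤ)))
  have : CharZero (FractionRing (AddMonoidAlgebra ℚ (Fin n → ℤ))) :=
    charZero_of_injective_algebraMap (algebraMap ℚ _).injective
  refine denominator_identity n r hr E (fun u v => ?_) ?_ (fun u v h => ?_) ρ hρ ρup hρup β hβ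
  · rw [hE, hE, hE, ← map_mul, AddMonoidAlgebra.single_mul_single, one_mul]
  · rw [hE, ← AddMonoidAlgebra.one_def, map_one]
  · rw [hE, hE] at h
    exact (AddMonoidAlgebra.single_left_inj one_ne_zero).1 (hmap h)
end

section
/- (Thin denominator identity, nested form.) Let n ≥ 2, r = ⌊n/2⌋, ρ = Σ_{i=1}^n (n−i)ε_i, β_k = −(ε_{2k−1}+ε_{2k}). Then e^{ρ} · ∏_{i<j}(1 − e^{ε_j−ε_i}) / ∏_{i<j}(1 − e^{ε_i+ε_j}) = Σ_{w ∈ S_n} sgn(w) · w( e^{ρ} / [ (1−e^{−β_1})(1−e^{−β_1−β_2}) ⋯ (1−e^{−β_1−⋯−β_r}) ] ). -/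
open Finset

open Polynomial in
/-- Obtained by interpolating `∏ (1 - x_i t) / (1 - t ^ 2)` at the nodes `x_i` and evaluating at
`t = 0`. -/
theorem sum_prod_mul_div_sub {K ι : Type*} [Field K] [DecidableEq ι] (h2 : (2 : K) ≠ 0)
    (s : Finset ι) (x : ι → K) (hx : Set.InjOn x s) (hs : ∀ i ∈ s, x i * x i ≠ 1) :
    ∑ a ∈ s, ∏ i ∈ s.erase a, x i * (1 - x a * x i) / (x i - x a) =
      1 - if Even #s then ∏ i ∈ s, x i else 0 := by
  obtain ⟨e, he⟩ : ∃ e, e = if Even #s then 0 else 1 := ⟨_, rfl⟩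
  have he1 : e ≤ 1 := by rw [he]; split_ifs <;> simp
  have hpar : (-1 : K) ^ (e + #s) = 1 := by
    rw [he]
    split_ifs with h
    · simpa using h.neg_one_pow
    · rw [Nat.not_even_iff_odd] at h
      exact (h.one_add).neg_one_pow
  set N : K[X] := ∏ i ∈ s, (X - C (x i)) with hN
  set R : K[X] := ∏ i ∈ s, (1 - C (x i) * X) with hR
  have hcop : IsCoprime (X - C (1 : K)) (X - C (-1 : K)) := by
    apply isCoprime_X_sub_C_of_isUnit_sub
    rw [sub_neg_eq_add, one_add_one_eq_two]
    exact h2.isUnit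
  have hdvd : (X - C (1 : K)) * (X - C (-1 : K)) ∣ R - X ^ e * N := by
    refine hcop.mul_dvd (dvd_iff_isRoot.2 ?_) (dvd_iff_isRoot.2 ?_)
    · simp [IsRoot, hR, hN, eval_prod]
    · simp only [IsRoot, hR, hN, eval_sub, eval_mul, eval_pow, eval_prod, eval_X, eval_C, eval_one]
      have : ∏ i ∈ s, (-1 - x i) = (-1) ^ #s * ∏ i ∈ s, (1 - x i * -1) := by
        rw [← prod_const, ← prod_mul_distrib]
        exact prod_congr rfl fun i _ => by ring
      rw [this, ← mul_assoc, ← pow_add, hpar, one_mul, sub_self]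
  obtain ⟨L, hL⟩ := hdvd
  have hNdeg : (X ^ e * N).natDegree ≤ e + #s := by
    refine natDegree_mul_le.trans (add_le_add (natDegree_X_pow_le _) ?_)
    rw [hN, natDegree_finsetProd_X_sub_C_eq_card]
  have hRdeg : R.natDegree ≤ #s := by
    refine (natDegree_prod_le _ _).trans ?_
    rw [card_eq_sum_ones]
    refine sum_le_sum fun i _ => ?_
    compute_degree
  have hLdeg : L.degree < #s := by
    by_cases hL0 : L = 0
    · rw [hL0, degree_zero]; exact WithBot.bot_lt_coe _
    rw [← natDegree_lt_iff_degree_lt hL0]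
    have h1 : (R - X ^ e * N).natDegree ≤ e + #s :=
      (natDegree_sub_le _ _).trans (max_le (hRdeg.trans (Nat.le_add_left _ _)) hNdeg)
    rw [hL, natDegree_mul (mul_ne_zero (X_sub_C_ne_zero _) (X_sub_C_ne_zero _)) hL0,
      natDegree_mul (X_sub_C_ne_zero _) (X_sub_C_ne_zero _), natDegree_X_sub_C,
      natDegree_X_sub_C] at h1
    omega
  have hLx : ∀ a ∈ s, L.eval (x a) = - ∏ i ∈ s.erase a, (1 - x a * x i) := by
    intro a ha
    have h := congrArg (eval (x a)) hL
    have h0 : ∏ i ∈ s, (x a - x i) = 0 := prod_eq_zero ha (sub_self _)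
    simp only [hR, hN, eval_sub, eval_mul, eval_pow, eval_prod, eval_X, eval_C, eval_one, h0,
      mul_zero, sub_zero] at h
    rw [← mul_prod_erase _ _ ha] at h
    have h3 : 1 - x a * x a ≠ 0 := sub_ne_zero.2 (hs a ha).symm
    simp_rw [mul_comm (x a)]
    apply mul_left_cancel₀ h3
    rw [mul_neg, h]; ring
  have key := congrArg (eval 0) (Lagrange.eq_interpolate hx hLdeg)
  rw [Lagrange.interpolate_apply, eval_finsetSum] at key
  have h0 := congrArg (eval 0) hL
  simp only [hR, hN, eval_sub, eval_mul, eval_pow, eval_prod, eval_X, eval_C, eval_one,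
    mul_zero, sub_zero, prod_const_one, zero_sub] at h0
  have : (0 : K) ^ e * ∏ i ∈ s, -x i = if Even #s then ∏ i ∈ s, x i else 0 := by
    rw [he]
    split_ifs with h
    · rw [prod_neg, h.neg_one_pow]; simp
    · simp
  rw [this] at h0
  rw [h0, key, neg_neg, mul_one, neg_one_mul, ← sum_neg_distrib]
  refine sum_congr rfl fun a ha => ?_
  rw [eval_mul, eval_C, hLx a ha, Lagrange.basis, eval_prod, neg_mul, neg_neg, ← prod_mul_distrib]
  refine prod_congr rfl fun i hi => ?_
  have hne : x i - x a ≠ 0 := sub_ne_zero.2 fun h =>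
    ne_of_mem_erase hi (hx (mem_of_mem_erase hi) ha h)
  have hne' : x a - x i ≠ 0 := by rwa [← neg_sub, neg_ne_zero]
  simp only [Lagrange.basisDivisor, eval_mul, eval_C, eval_sub, eval_X]
  field_simp
  ring

/-- The term indexed by the identity permutation in the nested thin denominator identity. -/
def nestedTerm {K : Type*} [Field K] {n : ℕ} (y : Fin n → K) : K :=
  (∏ i : Fin n, y i ^ (n - 1 - i.val)) /
    ∏ k ∈ range (n / 2), (1 - ∏ i : Fin n, if i.val < 2 * k + 2 then y i else 1)

/-- The product `∏_{i<j} (x_i - x_j) / (1 - x_i x_j)`. -/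
def pairProd {K : Type*} [Field K] {n : ℕ} (x : Fin n → K) : K :=
  ∏ i, ∏ j ∈ Ioi i, (x i - x j) / (1 - x i * x j)

theorem nestedTerm_succ {K : Type*} [Field K] {n : ℕ} (y : Fin (n + 1) → K) :
    nestedTerm y = nestedTerm (y ∘ Fin.castSucc) * (∏ i : Fin n, y i.castSucc) /
      (1 - if Even (n + 1) then ∏ i, y i else 0) := by
  have hnum : ∏ i : Fin (n + 1), y i ^ (n + 1 - 1 - i.val) =
      (∏ i : Fin n, y i.castSucc ^ (n - 1 - i.val)) * ∏ i : Fin n, y i.castSucc := by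
    rw [Fin.prod_univ_castSucc, ← prod_mul_distrib]
    simp only [Fin.val_last, Fin.val_castSucc, Nat.add_sub_cancel, Nat.sub_self, pow_zero, mul_one]
    refine prod_congr rfl fun i _ => ?_
    rw [← pow_succ]
    congr 1
    omega
  have hden : ∀ k ∈ range (n / 2),
      (1 - ∏ i : Fin (n + 1), if i.val < 2 * k + 2 then y i else 1) =
        1 - ∏ i : Fin n, if i.val < 2 * k + 2 then y i.castSucc else 1 := by
    intro k hk
    rw [mem_range] at hk
    rw [Fin.prod_univ_castSucc]
    simp [show ¬ n < 2 * k + 2 by omega]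
  rw [nestedTerm, nestedTerm, hnum]
  simp only [Function.comp_apply]
  split_ifs with h
  · rw [show (n + 1) / 2 = n / 2 + 1 by rcases h with ⟨m, hm⟩; omega, prod_range_succ,
      prod_congr rfl hden]
    have : (∏ i : Fin (n + 1), if i.val < 2 * (n / 2) + 2 then y i else 1) = ∏ i, y i :=
      prod_congr rfl fun i _ => if_pos (by omega)
    rw [this, div_mul_eq_mul_div, div_div]
  · rw [show (n + 1) / 2 = n / 2 by rw [Nat.not_even_iff] at h; omega, prod_congr rfl hden]
    ring

theorem pairProd_comp_perm {K : Type*} [Field K] {n : ℕ} (x : Fin n → K)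
    (w : Equiv.Perm (Fin n)) :
    pairProd (x ∘ w) = ((Equiv.Perm.sign w : ℤ) : K) * pairProd x :=
  w.prod_Ioi_comp_eq_sign_mul_prod (f := fun i j => (x i - x j) / (1 - x i * x j))
    fun i j => by rw [← neg_div, neg_sub, mul_comm]

theorem pairProd_succ {K : Type*} [Field K] {n : ℕ} (x : Fin (n + 1) → K) :
    pairProd x = (∏ i : Fin n, (x 0 - x i.succ) / (1 - x 0 * x i.succ)) *
      pairProd (x ∘ Fin.succ) := by
  simp [pairProd, Fin.prod_univ_succ, Fin.prod_Ioi_succ, mul_div_mul_comm]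

theorem prod_comp_swap_succ {M : Type*} [CommMonoid M] {n : ℕ} (f : Fin (n + 1) → M)
    (p : Fin (n + 1)) :
    ∏ i : Fin n, f (Equiv.swap 0 p i.succ) = ∏ i ∈ univ.erase p, f i := by
  refine prod_bij (fun i _ => Equiv.swap 0 p i.succ) (fun i _ => ?_) (fun i _ j _ h => ?_)
    (fun j hj => ?_) fun i _ => rfl
  · refine mem_erase.2 ⟨fun h => ?_, mem_univ _⟩
    rw [Equiv.swap_apply_eq_iff, Equiv.swap_apply_right] at h
    exact Fin.succ_ne_zero i h
  · simpa using h
  · have hne : Equiv.swap 0 p j ≠ 0 := by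
      intro h
      apply ne_of_mem_erase hj
      rwa [Equiv.swap_apply_eq_iff, Equiv.swap_apply_left] at h
    obtain ⟨i, hi⟩ := Fin.exists_succ_eq.2 hne
    exact ⟨i, mem_univ _, by rw [hi, Equiv.swap_apply_self]⟩

/-- Splitting a signed sum over permutations by the image of the last index. -/
theorem sum_sign_mul_comp_succ {K : Type*} [Field K] {n : ℕ} (x : Fin (n + 1) → K)
    (g : (Fin n → K) → K → K) :
    ∑ w : Equiv.Perm (Fin (n + 1)), ((Equiv.Perm.sign w : ℤ) : K) *
        g (x ∘ w ∘ Fin.castSucc) (x (w (Fin.last n))) =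
      ∑ p, (-1) ^ n * ((Equiv.Perm.sign (Equiv.swap 0 p) : ℤ) : K) *
        ∑ σ : Equiv.Perm (Fin n), ((Equiv.Perm.sign σ : ℤ) : K) *
          g (x ∘ Equiv.swap 0 p ∘ Fin.succ ∘ σ) (x p) := by
  rw [← Equiv.sum_comp (Equiv.mulRight (finRotate (n + 1))),
    ← Equiv.sum_comp Equiv.Perm.decomposeFin.symm, Fintype.sum_prod_type]
  refine sum_congr rfl fun p _ => ?_
  rw [mul_sum]
  refine sum_congr rfl fun σ _ => ?_
  have h1 : (x ∘ ⇑(Equiv.mulRight (finRotate (n + 1)) (Equiv.Perm.decomposeFin.symm (p, σ))) ∘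
      Fin.castSucc) = x ∘ Equiv.swap 0 p ∘ Fin.succ ∘ σ := by
    ext i
    simp
  have h2 : Equiv.mulRight (finRotate (n + 1)) (Equiv.Perm.decomposeFin.symm (p, σ))
      (Fin.last n) = p := by
    simp
  rw [h1, h2]
  simp only [Equiv.coe_mulRight, Equiv.Perm.sign_mul, sign_finRotate,
    Equiv.Perm.decomposeFin.symm_sign, Equiv.Perm.sign_swap', eq_comm (a := p)]
  push_cast
  ring

/-- The nested thin denominator identity for generic elements of a field. -/
theorem sum_sign_mul_nestedTerm {K : Type*} [Field K] (h2 : (2 : K) ≠ 0) {n : ℕ}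
    (x : Fin n → K) (hx : Function.Injective x) (hmul : ∀ i j, x i * x j ≠ 1)
    (hprod : ∀ s : Finset (Fin n), s.Nonempty → ∏ i ∈ s, x i ≠ 1) :
    ∑ w : Equiv.Perm (Fin n), ((Equiv.Perm.sign w : ℤ) : K) * nestedTerm (x ∘ w) =
      pairProd x := by
  induction n with
  | zero => simp [nestedTerm, pairProd]
  | succ n ih =>
    set D : K := 1 - if Even (n + 1) then ∏ i, x i else 0 with hD
    have hD0 : D ≠ 0 := by
      rw [hD]
      split_ifs
      · exact sub_ne_zero.2 (hprod univ univ_nonempty).symm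
      · simp
    have hterm (w : Equiv.Perm (Fin (n + 1))) : nestedTerm (x ∘ w) =
        nestedTerm (x ∘ w ∘ Fin.castSucc) *
          (∏ i, (x ∘ w ∘ Fin.castSucc) i) / D := by
      rw [nestedTerm_succ, hD, ← Equiv.prod_comp w x]
      rfl
    simp_rw [hterm]
    rw [sum_sign_mul_comp_succ x fun y _ => nestedTerm y * (∏ i, y i) / D]
    have hp (p : Fin (n + 1)) : (-1) ^ n * ((Equiv.Perm.sign (Equiv.swap 0 p) : ℤ) : K) *
        ∑ σ : Equiv.Perm (Fin n), ((Equiv.Perm.sign σ : ℤ) : K) *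
          (nestedTerm (x ∘ Equiv.swap 0 p ∘ Fin.succ ∘ σ) *
            (∏ i, (x ∘ Equiv.swap 0 p ∘ Fin.succ ∘ σ) i) / D) =
        pairProd x / D * ∏ i ∈ univ.erase p, x i * (1 - x p * x i) / (x i - x p) := by
      set e : Fin n → Fin (n + 1) := Equiv.swap 0 p ∘ Fin.succ with he
      have hinj : Function.Injective e := (Equiv.injective _).comp (Fin.succ_injective _)
      have hep (i : Fin n) : e i ≠ p := by
        intro h
        rw [he, Function.comp_apply, Equiv.swap_apply_eq_iff, Equiv.swap_apply_right] at h
        exact Fin.succ_ne_zero i h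
      have hσ (σ : Equiv.Perm (Fin n)) : ∏ i, (x ∘ e ∘ σ) i = ∏ i, x (e i) :=
        Equiv.prod_comp σ fun i => x (e i)
      have hih := ih (x ∘ e) (hx.comp hinj) (fun i j => hmul _ _) fun s hs => by
        simpa using hprod (s.map ⟨e, hinj⟩) (hs.map)
      have hsum : ∑ σ : Equiv.Perm (Fin n), ((Equiv.Perm.sign σ : ℤ) : K) *
          (nestedTerm (x ∘ e ∘ σ) * (∏ i, (x ∘ e ∘ σ) i) / D) =
          pairProd (x ∘ e) * ((∏ i, x (e i)) / D) := by
        rw [← hih, sum_mul]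
        refine sum_congr rfl fun σ _ => ?_
        rw [hσ, ← Function.comp_assoc x]
        ring
      have hpair := pairProd_comp_perm x (Equiv.swap 0 p)
      rw [pairProd_succ] at hpair
      simp only [Function.comp_apply, Equiv.swap_apply_left] at hpair
      have hsq : ((Equiv.Perm.sign (Equiv.swap 0 p) : ℤ) : K) *
          ((Equiv.Perm.sign (Equiv.swap 0 p) : ℤ) : K) = 1 := by
        rw [← Int.cast_mul, ← Units.val_mul, Int.units_mul_self]
        simp
      have hx' : pairProd x = ((Equiv.Perm.sign (Equiv.swap 0 p) : ℤ) : K) *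
          ((∏ i : Fin n, (x p - x (e i)) / (1 - x p * x (e i))) * pairProd (x ∘ e)) := by
        change _ = _ * (_ * pairProd ((x ∘ Equiv.swap 0 p) ∘ Fin.succ))
        simp only [he, Function.comp_apply]
        rw [hpair, ← mul_assoc, hsq, one_mul]
      have hcancel : (∏ i : Fin n, (x p - x (e i)) / (1 - x p * x (e i))) *
          ∏ i : Fin n, x (e i) * (1 - x p * x (e i)) / (x (e i) - x p) =
            (-1) ^ n * ∏ i, x (e i) := by
        rw [← prod_mul_distrib, ← Fin.prod_const, ← prod_mul_distrib]
        refine prod_congr rfl fun i _ => ?_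
        have h3 : 1 - x p * x (e i) ≠ 0 := sub_ne_zero.2 (hmul _ _).symm
        have h4 : x (e i) - x p ≠ 0 := sub_ne_zero.2 (hx.ne (hep i))
        field_simp
        ring
      rw [← prod_comp_swap_succ fun i => x i * (1 - x p * x i) / (x i - x p)]
      change _ * ∑ σ : Equiv.Perm (Fin n), _ * (nestedTerm (x ∘ e ∘ σ) *
        (∏ i, (x ∘ e ∘ σ) i) / D) = _ * ∏ i : Fin n, x (e i) * (1 - x p * x (e i)) / (x (e i) - x p)
      rw [hx']
      linear_combination (-1) ^ n * ((Equiv.Perm.sign (Equiv.swap 0 p) : ℤ) : K) * hsum -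
        ((Equiv.Perm.sign (Equiv.swap 0 p) : ℤ) : K) * pairProd (x ∘ e) / D * hcancel
    rw [sum_congr rfl fun p _ => hp p, ← mul_sum,
      sum_prod_mul_div_sub h2 univ x hx.injOn fun i _ => hmul i i, card_univ, Fintype.card_fin,
      ← hD, div_mul_cancel₀ _ hD0]

/-- Thin denominator identity, nested form.  With `r = ⌊n/2⌋`, `ρ = Σ (n−i)ε_i` and
`β_k = −(ε_{2k−1}+ε_{2k})`, in the fraction field of `ℚ[ℤ^n]`:
`e^ρ ∏_{i<j}(1−e^{ε_j−ε_i}) / ∏_{i<j}(1−e^{ε_i+ε_j})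
  = Σ_w sgn(w) w( e^ρ / [(1−e^{−β_1})(1−e^{−β_1−β_2})⋯(1−e^{−β_1−⋯−β_r})] )`. -/
theorem thin_denominator_nested (n : ℕ) (hn : 2 ≤ n) (r : ℕ) (hr : r = n / 2)
    (E : (Fin n → ℤ) → FractionRing (AddMonoidAlgebra ℚ (Fin n → ℤ)))
    (hE : ∀ v, E v = algebraMap _ _ (AddMonoidAlgebra.single v (1 : ℚ)))
    (ρ : Fin n → ℤ) (hρ : ρ = fun i => (n : ℤ) - 1 - (i.val : ℤ))
    (β : Fin r → (Fin n → ℤ))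
    (hβ : ∀ k, β k = fun i => if i.val = 2 * k.val ∨ i.val = 2 * k.val + 1 then -1 else 0) :
    E ρ * (∏ p ∈ univ.filter (fun p : Fin n × Fin n => p.1 < p.2),
        (1 - E (Pi.single p.2 1 - Pi.single p.1 1)))
      / (∏ p ∈ univ.filter (fun p : Fin n × Fin n => p.1 < p.2),
        (1 - E (Pi.single p.1 1 + Pi.single p.2 1)))
    = ∑ w : Equiv.Perm (Fin n),
        ((Equiv.Perm.sign w : ℤ) : FractionRing (AddMonoidAlgebra ℚ (Fin n → ℤ))) *
          (E (ρ ∘ w.symm) /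
            ∏ k : Fin r, (1 - E ((-(∑ l ∈ univ.filter (fun l : Fin r => l ≤ k), β l)) ∘ w.symm))) := by
  subst hr
  have hE0 : E 0 = 1 := by rw [hE, ← AddMonoidAlgebra.one_def, map_one]
  have hadd (u v) : E (u + v) = E u * E v := by
    rw [hE, hE, hE, ← map_mul, AddMonoidAlgebra.single_mul_single, one_mul]
  have hinj : Function.Injective E := by
    intro u v h
    rw [hE, hE] at h
    exact (AddMonoidAlgebra.single_left_inj one_ne_zero).1
      (IsFractionRing.injective (AddMonoidAlgebra ℚ (Fin n → ℤ)) _ h)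
  set x : Fin n → FractionRing (AddMonoidAlgebra ℚ (Fin n → ℤ)) :=
    fun i => E (Pi.single i 1) with hxdef
  have hsum (s : Finset (Fin n)) (f : Fin n → Fin n → ℤ) : E (∑ i ∈ s, f i) = ∏ i ∈ s, E (f i) := by
    induction s using Finset.induction_on with
    | empty => simp [hE0]
    | insert a s ha ih => rw [sum_insert ha, prod_insert ha, hadd, ih]
  have hnsmul (m : ℕ) (v) : E (m • v) = E v ^ m := by
    induction m with
    | zero => simp [hE0]
    | succ m ih => rw [succ_nsmul, hadd, ih, pow_succ]
  have hnat (m : Fin n → ℕ) : E (fun i => (m i : ℤ)) = ∏ i, x i ^ m i := by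
    simp_rw [hxdef, ← hnsmul, ← hsum]
    congr 1
    ext j
    simp [Finset.sum_apply, Pi.single_apply]
  have hxinj : Function.Injective x := by
    intro i j h
    have := congrFun (hinj h) i
    by_contra hij
    simp [hij] at this
  have hxmul (i j) : x i * x j ≠ 1 := by
    rw [hxdef, ← hadd, ← hE0]
    intro h
    have := congrFun (hinj h) i
    simp only [Pi.add_apply, Pi.single_apply, Pi.zero_apply] at this
    split_ifs at this <;> simp_all
  have hxprod (s : Finset (Fin n)) (hs : s.Nonempty) : ∏ i ∈ s, x i ≠ 1 := by
    obtain ⟨i, hi⟩ := hs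
    rw [hxdef, ← hsum, ← hE0]
    intro h
    have := congrFun (hinj h) i
    simp [Finset.sum_apply, Pi.single_apply, hi] at this
  have h2 : (2 : FractionRing (AddMonoidAlgebra ℚ (Fin n → ℤ))) ≠ 0 := by
    have : CharZero (FractionRing (AddMonoidAlgebra ℚ (Fin n → ℤ))) := algebraRat.charZero _
    exact two_ne_zero
  have hpairs (f : Fin n → Fin n → FractionRing (AddMonoidAlgebra ℚ (Fin n → ℤ))) :
      ∏ p ∈ univ.filter (fun p : Fin n × Fin n => p.1 < p.2), f p.1 p.2 =
        ∏ i, ∏ j ∈ Ioi i, f i j := by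
    rw [prod_filter, Fintype.prod_prod_type]
    refine prod_congr rfl fun i _ => ?_
    rw [← prod_filter]
    congr 1
    ext j
    simp
  have hρw (w : Equiv.Perm (Fin n)) : E (ρ ∘ w.symm) = ∏ i, x (w i) ^ (n - 1 - i.val) := by
    rw [show ρ ∘ w.symm = fun i => ((n - 1 - (w.symm i).val : ℕ) : ℤ) by
      ext i; simp only [hρ, Function.comp_apply]; omega, hnat, ← Equiv.prod_comp w]
    simp
  have hβw (w : Equiv.Perm (Fin n)) (k : Fin (n / 2)) :
      E ((-(∑ l ∈ univ.filter (fun l : Fin (n / 2) => l ≤ k), β l)) ∘ w.symm) =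
        ∏ i : Fin n, if i.val < 2 * k.val + 2 then x (w i) else 1 := by
    have hβsum : -(∑ l ∈ univ.filter (fun l : Fin (n / 2) => l ≤ k), β l) =
        fun i : Fin n => ((if i.val < 2 * k.val + 2 then 1 else 0 : ℕ) : ℤ) := by
      ext i
      rw [Pi.neg_apply, Finset.sum_apply]
      simp only [hβ]
      split_ifs with h
      · rw [sum_eq_single (⟨i.val / 2, by omega⟩ : Fin (n / 2))]
        · rw [if_pos (by simp only; omega)]
          simp
        · intro l _ hl
          refine if_neg fun h' => hl (Fin.ext ?_)
          simp only
          omega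
        · intro h'
          rw [mem_filter, Fin.le_def] at h'
          refine absurd ⟨mem_univ _, ?_⟩ h'
          simp only
          omega
      · rw [sum_eq_zero]
        · simp
        · intro l hl
          have hlk : l.val ≤ k.val := (mem_filter.1 hl).2
          exact if_neg (by omega)
    rw [hβsum]
    change E (fun i => ((if (w.symm i).val < 2 * k.val + 2 then 1 else 0 : ℕ) : ℤ)) = _
    rw [hnat, ← Equiv.prod_comp w]
    refine prod_congr rfl fun i _ => ?_
    rw [Equiv.symm_apply_apply]
    split_ifs <;> simp
  have hterm (w : Equiv.Perm (Fin n)) : E (ρ ∘ w.symm) / ∏ k : Fin (n / 2),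
      (1 - E ((-(∑ l ∈ univ.filter (fun l : Fin (n / 2) => l ≤ k), β l)) ∘ w.symm)) =
        nestedTerm (x ∘ w) := by
    simp_rw [hρw, hβw]
    rw [nestedTerm, prod_range]
    rfl
  simp_rw [hterm]
  have hnum := hpairs fun i j => 1 - E (Pi.single j 1 - Pi.single i 1)
  have hden := hpairs fun i j => 1 - E (Pi.single i 1 + Pi.single j 1)
  beta_reduce at hnum hden
  rw [sum_sign_mul_nestedTerm h2 x hxinj hxmul hxprod, pairProd, hnum, hden]
  have hρ1 : E ρ = ∏ i : Fin n, ∏ _j ∈ Ioi i, x i := by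
    simpa using hρw (Equiv.refl _)
  rw [hρ1]
  simp_rw [← prod_mul_distrib, ← prod_div_distrib]
  refine prod_congr rfl fun i _ => prod_congr rfl fun j _ => ?_
  have hsub : x i * E (Pi.single j 1 - Pi.single i 1) = x j := by
    rw [hxdef, ← hadd, add_sub_cancel]
  rw [mul_sub, hsub, mul_one, hadd]
end

section
/- (Thick denominator identity for p(n).) Let n ≥ 1, ρ = −Σ_{i=1}^n i ε_i, and β_k = 2ε_{n+1−k} for 1 ≤ k ≤ n. Then e^{ρ} · ∏_{i<j}(1 − e^{ε_j−ε_i}) / ∏_{i ≤ j}(1 − e^{−ε_i−ε_j}) = Σ_{w ∈ S_n} sgn(w) · w( e^{ρ} / [ (1−e^{−β_1})(1−e^{−β_1−β_2}) ⋯ (1−e^{−β_1−⋯−β_n}) ] ), where β_1+⋯+β_k = 2(ε_{n−k+1}+⋯+ε_n). -/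
open Finset

section AlternatingSum

variable {K : Type*} [Field K]

/-- The product of `1 - x i * x j` over `i ≤ j`. -/
def prodOneSubPairs {n : ℕ} (x : Fin n → K) : K :=
  ∏ p ∈ univ.filter (fun p : Fin n × Fin n => p.1 ≤ p.2), (1 - x p.1 * x p.2)

lemma prod_filter_le_eq_prod_sym2 {n : ℕ} (f : Fin n → Fin n → K) (hf : ∀ i j, f i j = f j i) :
    ∏ p ∈ univ.filter (fun p : Fin n × Fin n => p.1 ≤ p.2), f p.1 p.2 =
      ∏ s : Sym2 (Fin n), Sym2.lift ⟨f, hf⟩ s := by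
  rw [← Equiv.prod_comp Sym2.sortEquiv.symm, ← Finset.prod_subtype_eq_prod_filter]
  simp [Finset.subtype_univ]

lemma prodOneSubPairs_comp_perm {n : ℕ} (x : Fin n → K) (σ : Equiv.Perm (Fin n)) :
    prodOneSubPairs (x ∘ σ) = prodOneSubPairs x := by
  have hinj : Function.Bijective (Sym2.map σ) :=
    Finite.injective_iff_bijective.mp (Sym2.map.injective σ.injective)
  unfold prodOneSubPairs
  rw [prod_filter_le_eq_prod_sym2 (fun i j => 1 - x i * x j) (fun i j => by ring),
    prod_filter_le_eq_prod_sym2 (fun i j => 1 - (x ∘ σ) i * (x ∘ σ) j) (fun i j => by ring)]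
  refine Eq.trans (Finset.prod_congr rfl fun s _ => ?_) (hinj.prod_comp _)
  induction s with
  | _ i j => simp

lemma prodOneSubPairs_succ {n : ℕ} (y : Fin (n + 1) → K) :
    prodOneSubPairs y = (∏ i, (1 - y 0 * y i)) * prodOneSubPairs (fun i => y i.succ) := by
  unfold prodOneSubPairs
  simp only [Finset.prod_filter, Fintype.prod_prod_type]
  rw [Fin.prod_univ_succ]
  simp [Fin.prod_univ_succ (n := n)]

lemma det_vandermonde_succ {n : ℕ} (y : Fin (n + 1) → K) :
    (Matrix.vandermonde y).det =
      (∏ i : Fin n, (y i.succ - y 0)) * (Matrix.vandermonde fun i : Fin n => y i.succ).det := by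
  simp only [Matrix.det_vandermonde]
  rw [Fin.prod_univ_succ]
  congr 1
  · rw [Fin.Ioi_zero_eq_map, Finset.prod_map]; simp
  · refine Finset.prod_congr rfl fun i _ => ?_
    rw [← Fin.map_succEmb_Ioi, Finset.prod_map]; simp

lemma sum_eval_prod_one_sub_div {n : ℕ} (x : Fin n → K) (h0 : ∀ i, x i ≠ 0)
    (hx : Function.Injective x) :
    ∑ m, (∏ i, (1 - x m * x i)) / (x m * ∏ i ∈ univ.erase m, (x i - x m)) =
      (∏ i, x i)⁻¹ - ∏ i, x i := by
  classical
  let v : Fin (n + 1) → K := Fin.cons 0 x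
  have hv : Function.Injective v := Fin.cons_injective_iff.mpr ⟨by rintro ⟨i, hi⟩; exact h0 i hi, hx⟩
  let P : Polynomial K := ∏ i, (1 - Polynomial.C (x i) * Polynomial.X)
  have hdeg : ∀ i ∈ (univ : Finset (Fin n)),
      (1 - Polynomial.C (x i) * Polynomial.X).natDegree ≤ 1 := fun i _ => by compute_degree
  have hP : P.natDegree ≤ n := by
    refine (Polynomial.natDegree_prod_le _ _).trans ((Finset.sum_le_sum hdeg).trans ?_)
    simp
  have hcoeff : P.coeff n = (-1) ^ n * ∏ i, x i := by
    have := Polynomial.coeff_prod_of_natDegree_le univ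
      (fun i => 1 - Polynomial.C (x i) * Polynomial.X) 1 hdeg
    simp only [card_univ, Fintype.card_fin, mul_one] at this
    rw [this]
    simp [Polynomial.coeff_one, Finset.prod_neg]
  have key := Lagrange.coeff_eq_sum (s := (univ : Finset (Fin (n + 1)))) (v := v)
    hv.injOn (P := P) (by
      refine Polynomial.degree_le_natDegree.trans_lt ?_
      simp only [card_univ, Fintype.card_fin]
      exact_mod_cast Nat.lt_succ_of_le hP)
  have herase : ∀ m : Fin n, (univ : Finset (Fin (n + 1))).erase m.succ =
      insert 0 ((univ.erase m).map (Fin.succEmb n)) := by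
    intro m
    ext i
    refine Fin.cases ?_ (fun i => ?_) i
    · simp [(Fin.succ_ne_zero m).symm]
    · simp [Fin.succ_ne_zero]
  have herase0 : (univ : Finset (Fin (n + 1))).erase 0 = univ.map (Fin.succEmb n) := by
    ext i
    refine Fin.cases ?_ (fun i => ?_) i <;> simp [Fin.succ_ne_zero]
  simp only [card_univ, Fintype.card_fin, Nat.add_sub_cancel] at key
  rw [Fin.sum_univ_succ, hcoeff, herase0] at key
  have hsign : ∀ m : Fin n, ∏ i ∈ univ.erase m, (x m - x i) =
      (-1) ^ (n - 1) * ∏ i ∈ univ.erase m, (x i - x m) := by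
    intro m
    simp_rw [← neg_sub (x _) (x m)]
    rw [Finset.prod_neg]
    simp
  have hterm : ∀ m : Fin n, P.eval (v m.succ) / ∏ j ∈ univ.erase m.succ, (v m.succ - v j) =
      (-1) ^ (n - 1) *
        ((∏ i, (1 - x m * x i)) / (x m * ∏ i ∈ univ.erase m, (x i - x m))) := by
    intro m
    rw [herase, Finset.prod_insert (by simp [Fin.succ_ne_zero]), Finset.prod_map]
    simp only [v, P, Fin.cons_zero, Fin.cons_succ, Fin.coe_succEmb, sub_zero, hsign,
      Polynomial.eval_prod]
    simp only [Polynomial.eval_sub, Polynomial.eval_one, Polynomial.eval_mul, Polynomial.eval_C,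
      Polynomial.eval_X, mul_comm (x _) (x m)]
    rcases neg_one_pow_eq_or K (n - 1) with h | h <;> rw [h] <;> simp [div_neg]
  simp_rw [hterm, ← Finset.mul_sum] at key
  rw [Finset.prod_map] at key
  simp only [v, P, Fin.cons_zero, Fin.cons_succ, Fin.coe_succEmb, zero_sub, Finset.prod_neg,
    Polynomial.eval_prod, card_univ, Fintype.card_fin] at key
  simp at key
  set S := ∑ m, (∏ i, (1 - x m * x i)) / (x m * ∏ i ∈ univ.erase m, (x i - x m)) with hS
  rcases n with _ | n
  · simp [hS]
  · rcases neg_one_pow_eq_or K n with h | h <;> rw [pow_succ] at key <;>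
      simp [h] at key <;> first | linear_combination key | linear_combination -key

/-- The alternating sum over `S_n` of `∏ x_i ^ i / ∏_k (1 - (x_k ⋯ x_n) ^ 2)`. -/
theorem sum_sign_mul_prod_pow_div {n : ℕ} (x : Fin n → K) (h0 : ∀ i, x i ≠ 0)
    (hx : Function.Injective x) (hpair : ∀ i j, x i * x j ≠ 1)
    (hprod : ∀ s : Finset (Fin n), s.Nonempty → (∏ i ∈ s, x i) ^ 2 ≠ 1) :
    ∑ σ : Equiv.Perm (Fin n), ((Equiv.Perm.sign σ : ℤ) : K) *
        ((∏ i, x (σ i) ^ (i.val + 1)) / ∏ k, (1 - (∏ i ∈ Ici k, x (σ i)) ^ 2)) =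
      (∏ i, x i) * (Matrix.vandermonde x).det / prodOneSubPairs x := by
  induction n with
  | zero => simp [prodOneSubPairs]
  | succ n ih =>
    have hP0 : ∏ i, x i ≠ 0 := Finset.prod_ne_zero_iff.mpr fun i _ => h0 i
    have hP1 : 1 - (∏ i, x i) ^ 2 ≠ 0 := sub_ne_zero.mpr (hprod univ univ_nonempty).symm
    have hD : prodOneSubPairs x ≠ 0 :=
      Finset.prod_ne_zero_iff.mpr fun p _ => sub_ne_zero.mpr (hpair p.1 p.2).symm
    have inner : ∀ p : Fin (n + 1), ∑ e : Equiv.Perm (Fin n),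
        ((Equiv.Perm.sign (Equiv.Perm.decomposeFin.symm (p, e)) : ℤ) : K) *
          ((∏ i, x (Equiv.Perm.decomposeFin.symm (p, e) i) ^ (i.val + 1)) /
            ∏ k, (1 - (∏ i ∈ Ici k, x (Equiv.Perm.decomposeFin.symm (p, e) i)) ^ 2)) =
        (∏ i, x i) ^ 2 * (Matrix.vandermonde x).det /
            ((1 - (∏ i, x i) ^ 2) * prodOneSubPairs x) *
          ((∏ i, (1 - x p * x i)) / (x p * ∏ i ∈ univ.erase p, (x i - x p))) := by
      intro p
      let τ : Equiv.Perm (Fin (n + 1)) := Equiv.swap 0 p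
      let y : Fin n → K := fun i => x (τ i.succ)
      have hτ0 : τ 0 = p := Equiv.swap_apply_left 0 p
      have hinj : Function.Injective fun i : Fin n => τ i.succ :=
        τ.injective.comp (Fin.succ_injective n)
      have hy := ih y (fun i => h0 _) (hx.comp hinj) (fun i j => hpair _ _) (fun s hs => by
        have := hprod (s.map ⟨_, hinj⟩) (hs.map)
        rwa [Finset.prod_map] at this)
      have hPy : ∏ i, x i = x p * ∏ i, y i := by
        rw [← Equiv.prod_comp τ, Fin.prod_univ_succ, hτ0]
      have hVy : ((Equiv.Perm.sign τ : ℤ) : K) * (Matrix.vandermonde x).det =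
          (∏ i ∈ univ.erase p, (x i - x p)) * (Matrix.vandermonde y).det := by
        have h1 := Matrix.det_permute τ (Matrix.vandermonde x)
        have h2 : (Matrix.vandermonde x).submatrix τ id = Matrix.vandermonde (x ∘ τ) := by
          ext i j; simp [Matrix.vandermonde_apply]
        rw [h2, det_vandermonde_succ] at h1
        rw [← h1]
        congr 1
        have h3 : (univ : Finset (Fin (n + 1))).erase p = univ.map ⟨_, hinj⟩ := by
          ext i
          obtain ⟨j, rfl⟩ := τ.surjective i
          rw [← hτ0]
          refine Fin.cases ?_ (fun i => ?_) j <;> simp [Fin.succ_ne_zero]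
        rw [h3, Finset.prod_map]
        simp [hτ0]
      have hDy : prodOneSubPairs x = (∏ i, (1 - x p * x i)) * prodOneSubPairs y := by
        rw [← prodOneSubPairs_comp_perm x τ, prodOneSubPairs_succ]
        congr 1
        simp only [Function.comp_apply, hτ0]
        exact Equiv.prod_comp τ fun i => 1 - x p * x i
      have hE : ∏ i ∈ univ.erase p, (x i - x p) ≠ 0 :=
        Finset.prod_ne_zero_iff.mpr fun i hi =>
          sub_ne_zero.mpr (hx.ne (Finset.ne_of_mem_erase hi))
      have hsign : ∀ e : Equiv.Perm (Fin n),
          ((Equiv.Perm.sign (Equiv.Perm.decomposeFin.symm (p, e)) : ℤ) : K) =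
            ((Equiv.Perm.sign τ : ℤ) : K) * ((Equiv.Perm.sign e : ℤ) : K) := by
        intro e
        rw [Equiv.Perm.decomposeFin.symm_sign, Equiv.Perm.sign_swap']
        simp only [eq_comm (a := (0 : Fin (n + 1)))]
        split_ifs <;> simp
      have hterm : ∀ e : Equiv.Perm (Fin n),
          (∏ i, x (Equiv.Perm.decomposeFin.symm (p, e) i) ^ (i.val + 1)) /
            ∏ k, (1 - (∏ i ∈ Ici k, x (Equiv.Perm.decomposeFin.symm (p, e) i)) ^ 2) =
          (∏ i, x i) / (1 - (∏ i, x i) ^ 2) * ((∏ i, y (e i) ^ (i.val + 1)) /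
            ∏ k, (1 - (∏ i ∈ Ici k, y (e i)) ^ 2)) := by
        intro e
        have hden : ∏ k, (1 - (∏ i ∈ Ici k, x (Equiv.Perm.decomposeFin.symm (p, e) i)) ^ 2) =
            (1 - (∏ i, x i) ^ 2) * ∏ k, (1 - (∏ i ∈ Ici k, y (e i)) ^ 2) := by
          rw [Fin.prod_univ_succ]
          congr 1
          · have : Ici (0 : Fin (n + 1)) = univ := by ext; simp
            rw [this, Equiv.prod_comp]
          · refine Finset.prod_congr rfl fun k _ => ?_
            rw [← Fin.map_succEmb_Ici, Finset.prod_map]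
            simp [y, τ]
        have hnum : ∏ i, x (Equiv.Perm.decomposeFin.symm (p, e) i) ^ (i.val + 1) =
            (∏ i, x i) * ∏ i, y (e i) ^ (i.val + 1) := by
          rw [Fin.prod_univ_succ, hPy, ← Equiv.prod_comp e y, mul_assoc, ← Finset.prod_mul_distrib]
          simp [y, τ, pow_succ']
        rw [hden, hnum, mul_div_mul_comm]
      simp_rw [hsign, hterm]
      have : ∀ e : Equiv.Perm (Fin n), ((Equiv.Perm.sign τ : ℤ) : K) *
          ((Equiv.Perm.sign e : ℤ) : K) * ((∏ i, x i) / (1 - (∏ i, x i) ^ 2) *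
            ((∏ i, y (e i) ^ (i.val + 1)) / ∏ k, (1 - (∏ i ∈ Ici k, y (e i)) ^ 2))) =
          ((Equiv.Perm.sign τ : ℤ) : K) * ((∏ i, x i) / (1 - (∏ i, x i) ^ 2)) *
          (((Equiv.Perm.sign e : ℤ) : K) *
            ((∏ i, y (e i) ^ (i.val + 1)) / ∏ k, (1 - (∏ i ∈ Ici k, y (e i)) ^ 2))) :=
        fun e => by ring
      simp_rw [this]
      rw [← Finset.mul_sum, hy]
      have hs : ((Equiv.Perm.sign τ : ℤ) : K) * ((Equiv.Perm.sign τ : ℤ) : K) = 1 := by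
        rcases Int.units_eq_one_or (Equiv.Perm.sign τ) with h | h <;> simp [h]
      have hVx : (Matrix.vandermonde x).det = ((Equiv.Perm.sign τ : ℤ) : K) *
          ((∏ i ∈ univ.erase p, (x i - x p)) * (Matrix.vandermonde y).det) := by
        rw [← hVy, ← mul_assoc, hs, one_mul]
      have hDy0 : (∏ i, (1 - x p * x i)) * prodOneSubPairs y ≠ 0 := hDy ▸ hD
      have hA := left_ne_zero_of_mul hDy0
      have hB := right_ne_zero_of_mul hDy0
      have hp := h0 p
      rw [hVx, hDy]
      set P := ∏ i, x i
      have hyP : ∏ i, y i = P / x p := by rw [hPy]; field_simp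
      rw [hyP]
      field_simp
    rw [← Equiv.sum_comp Equiv.Perm.decomposeFin.symm, Fintype.sum_prod_type]
    simp_rw [inner]
    rw [← Finset.mul_sum, sum_eval_prod_one_sub_div x h0 hx]
    field_simp

end AlternatingSum

lemma prod_pow_mul_prod_one_sub_div {K : Type*} [Field K] {n : ℕ} (x : Fin n → K)
    (h0 : ∀ i, x i ≠ 0) :
    (∏ i, x i ^ (i.val + 1)) *
        ∏ p ∈ univ.filter (fun p : Fin n × Fin n => p.1 < p.2), (1 - x p.1 / x p.2) =
      (∏ i, x i) * (Matrix.vandermonde x).det := by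
  have hpow : ∏ p ∈ univ.filter (fun p : Fin n × Fin n => p.1 < p.2), x p.2 =
      ∏ i, x i ^ i.val := by
    rw [Finset.prod_filter, Fintype.prod_prod_type_right]
    refine Finset.prod_congr rfl fun j _ => ?_
    dsimp only
    rw [← Finset.prod_filter, Finset.prod_const, Finset.filter_gt_eq_Iio, Fin.card_Iio]
  have hV : (Matrix.vandermonde x).det =
      ∏ p ∈ univ.filter (fun p : Fin n × Fin n => p.1 < p.2), (x p.2 - x p.1) := by
    rw [Matrix.det_vandermonde, Finset.prod_filter, Fintype.prod_prod_type]
    refine Finset.prod_congr rfl fun i _ => ?_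
    rw [← Finset.prod_filter, Finset.filter_lt_eq_Ioi]
  have hmul : ∏ p ∈ univ.filter (fun p : Fin n × Fin n => p.1 < p.2), (x p.2 - x p.1) =
      (∏ i, x i ^ i.val) *
        ∏ p ∈ univ.filter (fun p : Fin n × Fin n => p.1 < p.2), (1 - x p.1 / x p.2) := by
    rw [← hpow, ← Finset.prod_mul_distrib]
    refine Finset.prod_congr rfl fun p _ => ?_
    have := h0 p.2
    field_simp
  rw [hV, hmul, ← mul_assoc, ← Finset.prod_mul_distrib]
  simp only [pow_succ']

/-- Thick denominator identity for `p(n)`.  With `ρ = −Σ_{i=1}^n i ε_i`,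
`β_k = 2ε_{n+1−k}` and `β_1+⋯+β_k = 2(ε_{n−k+1}+⋯+ε_n)`, in the fraction field of
`ℚ[ℤ^n]`:
`e^ρ ∏_{i<j}(1−e^{ε_j−ε_i}) / ∏_{i≤j}(1−e^{−ε_i−ε_j})
  = Σ_w sgn(w) w( e^ρ / [(1−e^{−β_1})(1−e^{−β_1−β_2})⋯(1−e^{−β_1−⋯−β_n})] )`. -/
theorem thick_denominator (n : ℕ) (hn : 1 ≤ n)
    (E : (Fin n → ℤ) → FractionRing (AddMonoidAlgebra ℚ (Fin n → ℤ)))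
    (hE : ∀ v, E v = algebraMap _ _ (AddMonoidAlgebra.single v (1 : ℚ)))
    (ρ : Fin n → ℤ) (hρ : ρ = fun i => -((i.val : ℤ) + 1))
    (B : Fin n → (Fin n → ℤ))
    (hB : ∀ k, B k = fun i => if n - (k.val + 1) ≤ i.val then 2 else 0) :
    E ρ * (∏ p ∈ univ.filter (fun p : Fin n × Fin n => p.1 < p.2),
        (1 - E (Pi.single p.2 1 - Pi.single p.1 1)))
      / (∏ p ∈ univ.filter (fun p : Fin n × Fin n => p.1 ≤ p.2),
        (1 - E (-(Pi.single p.1 1 + Pi.single p.2 1))))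
    = ∑ w : Equiv.Perm (Fin n),
        ((Equiv.Perm.sign w : ℤ) : FractionRing (AddMonoidAlgebra ℚ (Fin n → ℤ))) *
          (E (ρ ∘ w.symm) / ∏ k : Fin n, (1 - E ((-(B k)) ∘ w.symm))) := by
  have hE0 : E 0 = 1 := by rw [hE]; exact map_one _
  have hadd : ∀ u v, E (u + v) = E u * E v := fun u v => by
    rw [hE, hE, hE, ← map_mul, AddMonoidAlgebra.single_mul_single, one_mul]
  have hinj : Function.Injective E := fun u v h => by
    rw [hE, hE] at h
    exact AddMonoidAlgebra.single_left_injective one_ne_zero (IsFractionRing.injective _ _ h)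
  let φ : Multiplicative (Fin n → ℤ) →* FractionRing (AddMonoidAlgebra ℚ (Fin n → ℤ)) :=
    { toFun := fun v => E v.toAdd, map_one' := hE0, map_mul' := fun u v => hadd _ _ }
  let x : Fin n → FractionRing (AddMonoidAlgebra ℚ (Fin n → ℤ)) := fun i => E (-Pi.single i 1)
  have hne : ∀ v, E v ≠ 0 := fun v h => by
    have := hadd v (-v)
    rw [add_neg_cancel, hE0, h, zero_mul] at this
    exact one_ne_zero this
  have hEprod : ∀ c : Fin n → ℕ, E (fun i => -(c i : ℤ)) = ∏ i, x i ^ c i := by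
    intro c
    have h1 : ∏ i, φ (Multiplicative.ofAdd (-Pi.single i 1)) ^ c i =
        φ (Multiplicative.ofAdd (∑ i, c i • (-Pi.single i 1))) := by
      simp only [ofAdd_sum, map_prod, ofAdd_nsmul, map_pow]
    refine Eq.trans ?_ h1.symm
    change E _ = E _
    congr 1
    ext j
    simp [Finset.sum_apply, Pi.single_apply]
  have hEperm : ∀ (c : Fin n → ℕ) (w : Equiv.Perm (Fin n)),
      E ((fun i => -(c i : ℤ)) ∘ w.symm) = ∏ i, x (w i) ^ c i := by
    intro c w
    refine (hEprod (c ∘ w.symm)).trans ?_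
    rw [← Equiv.prod_comp w]
    simp
  have h0 : ∀ i, x i ≠ 0 := fun i => hne _
  have hx : Function.Injective x := fun i j h => by
    have h1 := congrFun (hinj h) i
    by_contra hij
    simp [hij] at h1
  have hxx : ∀ i j, E (-(Pi.single i 1 + Pi.single j 1)) = x i * x j := fun i j => by
    rw [neg_add, hadd]
  have hpair : ∀ i j, x i * x j ≠ 1 := fun i j h => by
    rw [← hxx, ← hE0] at h
    have h1 := congrFun (hinj h) i
    simp only [Pi.neg_apply, Pi.add_apply, Pi.single_apply, Pi.zero_apply] at h1
    split_ifs at h1 <;> omega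
  have hsq : ∀ (s : Finset (Fin n)) (z : Fin n → FractionRing (AddMonoidAlgebra ℚ (Fin n → ℤ))),
      ∏ i, z i ^ (if i ∈ s then 2 else 0) = (∏ i ∈ s, z i) ^ 2 := by
    intro s z
    simp [pow_ite, Finset.prod_ite_mem, Finset.prod_pow]
  have hprod : ∀ s : Finset (Fin n), s.Nonempty → (∏ i ∈ s, x i) ^ 2 ≠ 1 := by
    rintro s ⟨i, hi⟩ h
    rw [← hsq, ← hEprod, ← hE0] at h
    have h1 := congrFun (hinj h) i
    simp [hi] at h1
  have hdiff : ∀ i j, E (Pi.single j 1 - Pi.single i 1) = x i / x j := fun i j => by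
    rw [eq_div_iff (h0 j), ← hadd]
    congr 1
    abel
  have hρE : ∀ w : Equiv.Perm (Fin n), E (ρ ∘ w.symm) = ∏ i, x (w i) ^ (i.val + 1) := fun w => by
    rw [← hEperm (fun i => i.val + 1) w, hρ]
    simp
  have hBE : ∀ (w : Equiv.Perm (Fin n)) (k : Fin n),
      E ((-(B k)) ∘ w.symm) = (∏ i ∈ Ici (Fin.revPerm k), x (w i)) ^ 2 := fun w k => by
    rw [← hsq _ (fun i => x (w i)), ← hEperm]
    congr 2
    ext i
    simp [hB, Fin.le_def, Fin.val_rev]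
  have hρ1 : E ρ = ∏ i, x i ^ (i.val + 1) := hρE 1
  simp_rw [hdiff, hxx, hρ1, hρE, hBE]
  rw [prod_pow_mul_prod_one_sub_div x h0]
  refine (sum_sign_mul_prod_pow_div x h0 hx hpair hprod).symm.trans ?_
  refine Finset.sum_congr rfl fun w _ => ?_
  rw [← Equiv.prod_comp Fin.revPerm fun k => 1 - (∏ i ∈ Ici k, x (w i)) ^ 2]
end
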